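/- arXiv:1404.7068 — 9 statements merged into one kernel-verified Lean document; each statement's English description precedes it below -/
import Mathlib

section
/- Let (P, μ) be a measure space and let ‖·‖ be a functional on μ-measurable extended-real-valued functions satisfying the lattice property (if |u| ≤ |v| μ-a.e. then ‖u‖ ≤ ‖v‖). Let u be μ-measurable with |u| < ∞ μ-a.e. and ‖u‖ < ∞, and suppose ‖·‖ is absolutely continuous at u, i.e., ‖u·χ_{E_n}‖ → 0 whenever (E_n) is a decreasing sequence of measurable sets with μ(⋂_n E_n) = 0. For σ > 0 let u_σ = max(min(u, σ), −σ) be the truncation of u at levels ±σ. Then ‖u − u_σ‖ → 0 as σ → ∞. -/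
open MeasureTheory Filter
open scoped ENNReal

/-- Subtracting a symmetric truncation at a level `σ ≥ 0` does not increase the absolute value. -/
theorem EReal.abs_sub_truncation_le {σ : ℝ} (hσ : 0 ≤ σ) (t : EReal) :
    (t - max (min t (σ : EReal)) (-(σ : EReal))).abs ≤ t.abs := by
  induction t with
  | bot => simp
  | top => simp
  | coe t =>
    rw [← EReal.coe_neg, ← EReal.coe_strictMono.monotone.map_min,
      ← EReal.coe_strictMono.monotone.map_max, ← EReal.coe_sub, EReal.abs_def,
      EReal.abs_def]
    apply ENNReal.ofReal_le_ofReal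
    grind

/-- The truncation at a level `σ` is the identity on `[-σ, σ]`. -/
theorem EReal.sub_truncation_eq_zero {σ : ℝ} {t : EReal} (h₁ : -(σ : EReal) ≤ t)
    (h₂ : t ≤ (σ : EReal)) : t - max (min t (σ : EReal)) (-(σ : EReal)) = 0 := by
  rw [min_eq_left h₂, max_eq_left h₁]
  refine EReal.sub_self (fun h => ?_) (fun h => ?_)
  · simp [h] at h₂
  · rw [h, ← EReal.coe_neg] at h₁
    simp at h₁

/-- **Truncations converge in quasi-norm under absolute continuity.**
Let `(P, μ)` be a measure space and `N` a functional on μ-measurable extended-real-valued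
functions satisfying the lattice property. If `u` is measurable, a.e. finite, has finite
quasi-norm, and the quasi-norm is absolutely continuous at `u`, then the truncations
`u_σ = max (min u σ) (-σ)` satisfy `‖u - u_σ‖ → 0` as `σ → ∞`. -/
theorem truncations_tendsto_of_absolutelyContinuous
    {P : Type*} [MeasurableSpace P] (μ : Measure P)
    (N : (P → EReal) → ℝ≥0∞)
    (hlattice : ∀ u v : P → EReal, Measurable u → Measurable v →
      (∀ᵐ x ∂μ, (u x).abs ≤ (v x).abs) → N u ≤ N v)
    (u : P → EReal) (hu : Measurable u)
    (hfin : ∀ᵐ x ∂μ, (u x).abs < ⊤)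
    (hNu : N u < ⊤)
    (hAC : ∀ E : ℕ → Set P, (∀ n, MeasurableSet (E n)) → (∀ n, E (n + 1) ⊆ E n) →
      μ (⋂ n, E n) = 0 →
      Tendsto (fun n => N ((E n).indicator u)) atTop (nhds 0)) :
    Tendsto (fun σ : ℝ => N (fun x => u x - max (min (u x) (σ : EReal)) (-(σ : EReal))))
      atTop (nhds 0) := by
  set E : ℕ → Set P := fun n => {x | u x < -((n : ℝ) : EReal)} ∪ {x | ((n : ℝ) : EReal) < u x}
  have hE : ∀ n, MeasurableSet (E n) := fun n =>
    (measurableSet_lt hu measurable_const).union (measurableSet_lt measurable_const hu)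
  have hanti : ∀ n, E (n + 1) ⊆ E n := by
    intro n x hx
    have h : ((n : ℝ) : EReal) ≤ ((n + 1 : ℕ) : ℝ) := by
      exact_mod_cast n.le_succ
    exact hx.imp (fun hx => hx.trans_le (EReal.neg_le_neg_iff.2 h)) h.trans_lt
  have hnull : μ (⋂ n, E n) = 0 := by
    refine measure_mono_null (t := {x | ¬ (u x).abs < ⊤}) ?_ (ae_iff.1 hfin)
    intro x hx hlt
    rw [Set.mem_iInter] at hx
    replace hlt : (u x).abs < ⊤ := hlt
    generalize ht : u x = t at hlt
    induction t with
    | bot => simp at hlt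
    | top => simp at hlt
    | coe t =>
      obtain ⟨n, hn⟩ := exists_nat_ge |t|
      have h := hx n
      simp only [E, Set.mem_union, Set.mem_ofPred_eq, ht, ← EReal.coe_neg, EReal.coe_lt_coe_iff] at h
      grind
  have hlim := hAC E hE hanti hnull
  refine tendsto_of_tendsto_of_tendsto_of_le_of_le' tendsto_const_nhds
    (hlim.comp (tendsto_nat_floor_atTop (α := ℝ))) (Eventually.of_forall fun _ => zero_le) ?_
  filter_upwards [eventually_ge_atTop 0] with σ hσ
  refine hlattice _ _ (by fun_prop) (hu.indicator (hE _)) (Eventually.of_forall fun x => ?_)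
  by_cases hx : x ∈ E ⌊σ⌋₊
  · rw [Set.indicator_of_mem hx]
    exact EReal.abs_sub_truncation_le hσ (u x)
  · have hfloor : ((⌊σ⌋₊ : ℝ) : EReal) ≤ σ := EReal.coe_le_coe_iff.2 (Nat.floor_le hσ)
    have hx' : -((⌊σ⌋₊ : ℝ) : EReal) ≤ u x ∧ u x ≤ ((⌊σ⌋₊ : ℝ) : EReal) := by
      simpa only [E, Set.mem_union, Set.mem_ofPred_eq, not_or, not_lt] using hx
    rw [EReal.sub_truncation_eq_zero ((EReal.neg_le_neg_iff.2 hfloor).trans hx'.1)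
      (hx'.2.trans hfloor)]
    simp
end

section
/- Let φ be quasi-concave, let q ∈ [1,∞), and let f : (0,∞) → [0,∞] be nonincreasing. Then sup_{t>0} f(t)·φ(t) ≤ q^{1/q} · ( ∫₀^∞ (f(t)·φ(t))^q dt/t )^{1/q}. -/
open MeasureTheory
open scoped ENNReal

/-- A function `φ : [0,∞) → [0,∞)` is quasi-concave: `φ 0 = 0`, `φ > 0` on `(0,∞)`,
`φ` is nondecreasing on `[0,∞)`, and `t ↦ φ t / t` is nonincreasing on `(0,∞)`. -/
def QuasiConcave (φ : ℝ → ℝ) : Prop :=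
  φ 0 = 0 ∧ (∀ t : ℝ, 0 < t → 0 < φ t) ∧ MonotoneOn φ (Set.Ici 0) ∧
    AntitoneOn (fun t => φ t / t) (Set.Ioi 0)

/-- The integral of `s ^ (q - 1) / t ^ q` over `(0, t]` is `1 / q`. -/
theorem lintegral_Ioc_rpow_sub_one_div {q t : ℝ} (hq : 1 ≤ q) (ht : 0 < t) :
    ∫⁻ s in Set.Ioc 0 t, ENNReal.ofReal (s ^ (q - 1) / t ^ q) = ENNReal.ofReal (1 / q) := by
  have hint : IntervalIntegrable (fun s : ℝ => s ^ (q - 1) / t ^ q) volume 0 t :=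
    (intervalIntegral.intervalIntegrable_rpow' (by linarith)).div_const _
  rw [← ofReal_integral_eq_lintegral_ofReal
    ((intervalIntegrable_iff_integrableOn_Ioc_of_le ht.le).1 hint)]
  · rw [← intervalIntegral.integral_of_le ht.le, intervalIntegral.integral_div,
      integral_rpow (Or.inl (by linarith)), sub_add_cancel, Real.zero_rpow (by linarith), sub_zero]
    have : t ^ q ≠ 0 := (Real.rpow_pos_of_pos ht q).ne'
    congr 1
    field_simp
  · filter_upwards [ae_restrict_mem measurableSet_Ioc] with s hs
    exact div_nonneg (Real.rpow_nonneg hs.1.le _) (Real.rpow_nonneg ht.le _)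

/-- A nonincreasing function times a quasi-concave one loses at most the factor `s / t` when
passing from `t` to a smaller `s`. -/
theorem QuasiConcave.mul_ofReal_div_le {φ : ℝ → ℝ} (hφ : QuasiConcave φ) {f : ℝ → ℝ≥0∞}
    (hf : AntitoneOn f (Set.Ioi 0)) {s t : ℝ} (hs : 0 < s) (hst : s ≤ t) :
    f t * ENNReal.ofReal (φ t) * ENNReal.ofReal (s / t) ≤ f s * ENNReal.ofReal (φ s) := by
  obtain ⟨-, hpos, -, hanti⟩ := hφ
  have ht : 0 < t := hs.trans_le hst
  rw [mul_assoc, ← ENNReal.ofReal_mul (hpos t ht).le]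
  refine mul_le_mul' (hf hs ht hst) (ENNReal.ofReal_le_ofReal ?_)
  have h : φ t / t ≤ φ s / s := hanti hs ht hst
  calc φ t * (s / t) = φ t / t * s := by ring
    _ ≤ φ s / s * s := by gcongr
    _ = φ s := div_mul_cancel₀ _ hs.ne'

/-- **The weak Marcinkiewicz quasi-norm is dominated by the Lorentz `Λ^q_φ` quasi-norm:**
for quasi-concave `φ`, `q ∈ [1,∞)` and nonincreasing `f : (0,∞) → [0,∞]`,
`sup_{t>0} f(t)·φ(t) ≤ q^{1/q} · (∫₀^∞ (f(t)·φ(t))^q dt/t)^{1/q}`. -/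
theorem sup_le_lorentz_norm
    (φ : ℝ → ℝ) (hφ : QuasiConcave φ) (q : ℝ) (hq : 1 ≤ q)
    (f : ℝ → ℝ≥0∞) (hf : AntitoneOn f (Set.Ioi 0)) :
    (⨆ t ∈ Set.Ioi (0 : ℝ), f t * ENNReal.ofReal (φ t)) ≤
      ENNReal.ofReal (q ^ (1 / q)) *
        (∫⁻ t in Set.Ioi (0 : ℝ),
          (f t * ENNReal.ofReal (φ t)) ^ q * ENNReal.ofReal (1 / t)) ^ (1 / q) := by
  have hq0 : 0 < q := by linarith
  refine iSup₂_le fun t ht => ?_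
  have ht0 : 0 < t := ht
  set A := f t * ENNReal.ofReal (φ t)
  set I := ∫⁻ t in Set.Ioi (0 : ℝ),
    (f t * ENNReal.ofReal (φ t)) ^ q * ENNReal.ofReal (1 / t)
  have key : A ^ q * ENNReal.ofReal (1 / q) ≤ I := by
    rw [← lintegral_Ioc_rpow_sub_one_div hq ht0, ← lintegral_const_mul _ (by fun_prop)]
    refine (setLIntegral_mono_ae' measurableSet_Ioc (.of_forall fun s hs => ?_)).trans
      (lintegral_mono_set Set.Ioc_subset_Ioi_self)
    have hs0 : 0 < s := hs.1
    have hpow : s ^ (q - 1) / t ^ q = (s / t) ^ q * (1 / s) := by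
      rw [Real.div_rpow hs0.le ht0.le, Real.rpow_sub_one hs0.ne']
      ring
    rw [hpow, ENNReal.ofReal_mul (by positivity), ← mul_assoc,
      ← ENNReal.ofReal_rpow_of_nonneg (by positivity) hq0.le,
      ← ENNReal.mul_rpow_of_nonneg _ _ hq0.le]
    exact mul_le_mul_left
      (ENNReal.rpow_le_rpow (hφ.mul_ofReal_div_le hf hs0 hs.2) hq0.le) _
  have hAI : A ^ q ≤ ENNReal.ofReal q * I := by
    calc A ^ q = ENNReal.ofReal q * (A ^ q * ENNReal.ofReal (1 / q)) := by
          rw [mul_left_comm, ← ENNReal.ofReal_mul hq0.le, mul_one_div_cancel hq0.ne',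
            ENNReal.ofReal_one, mul_one]
      _ ≤ _ := by gcongr
  rw [← ENNReal.ofReal_rpow_of_nonneg hq0.le (by positivity),
    ← ENNReal.mul_rpow_of_nonneg _ _ (by positivity)]
  rw [one_div]
  exact (ENNReal.le_rpow_inv_iff hq0).2 hAI
end

section
/- Let φ be quasi-concave, let 1 ≤ q < p < ∞, and let f : (0,∞) → [0,∞] be nonincreasing. Then ( ∫₀^∞ (f(t)·φ(t))^p dt/t )^{1/p} ≤ q^{1/q − 1/p} · ( ∫₀^∞ (f(t)·φ(t))^q dt/t )^{1/q}. (This expresses the embedding Λ^q_φ ↪ Λ^p_φ of classical Lorentz spaces, with embedding norm independent of φ.) -/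
open MeasureTheory
open scoped ENNReal

theorem lintegral_Ioc_rpow_sub_one {q t : ℝ} (hq : 0 < q) (ht : 0 < t) :
    ∫⁻ s in Set.Ioc 0 t, ENNReal.ofReal (s ^ (q - 1)) = ENNReal.ofReal (t ^ q / q) := by
  have hint : IntervalIntegrable (fun s : ℝ => s ^ (q - 1)) volume 0 t :=
    intervalIntegral.intervalIntegrable_rpow' (by linarith)
  rw [← ofReal_integral_eq_lintegral_ofReal
    ((intervalIntegrable_iff_integrableOn_Ioc_of_le ht.le).1 hint),
    ← intervalIntegral.integral_of_le ht.le, integral_rpow (Or.inl (by linarith))]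
  · rw [sub_add_cancel, Real.zero_rpow hq.ne', sub_zero]
  · filter_upwards [ae_restrict_mem measurableSet_Ioc] with s hs
    exact Real.rpow_nonneg hs.1.le _

/-- The weak-type bound `Λ^q_φ ↪ Λ^∞_φ`, raised to the power `q`. -/
theorem rpow_mul_le_lintegral {φ : ℝ → ℝ}
    (hφ : AntitoneOn (fun t => φ t / t) (Set.Ioi 0)) {q : ℝ} (hq : 0 < q)
    {f : ℝ → ℝ≥0∞} (hf : AntitoneOn f (Set.Ioi 0)) {t : ℝ} (ht : 0 < t) :
    (f t * ENNReal.ofReal (φ t)) ^ q ≤ ENNReal.ofReal q *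
      ∫⁻ s in Set.Ioi (0 : ℝ), (f s * ENNReal.ofReal (φ s)) ^ q * ENNReal.ofReal (1 / s) := by
  have key : (f t * ENNReal.ofReal (φ t / t)) ^ q * ENNReal.ofReal (t ^ q / q) ≤
      ∫⁻ s in Set.Ioi (0 : ℝ), (f s * ENNReal.ofReal (φ s)) ^ q * ENNReal.ofReal (1 / s) := by
    rw [← lintegral_Ioc_rpow_sub_one hq ht, ← lintegral_const_mul _ (by fun_prop)]
    refine (setLIntegral_mono' measurableSet_Ioc fun s hs => ?_).trans
      (lintegral_mono_set Set.Ioc_subset_Ioi_self)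
    have hs0 : 0 < s := hs.1
    have hpow : ENNReal.ofReal (s ^ (q - 1)) =
        ENNReal.ofReal s ^ q * ENNReal.ofReal (1 / s) := by
      rw [ENNReal.ofReal_rpow_of_pos hs0, ← ENNReal.ofReal_mul (by positivity),
        Real.rpow_sub_one hs0.ne', mul_one_div]
    rw [hpow, ← mul_assoc, ← ENNReal.mul_rpow_of_nonneg _ _ hq.le, mul_assoc (f t),
      ← ENNReal.ofReal_mul' hs0.le]
    gcongr
    · exact hf hs0 ht hs.2
    · exact (le_div_iff₀ hs0).1 (hφ hs0 ht hs.2)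
  calc (f t * ENNReal.ofReal (φ t)) ^ q
      = ENNReal.ofReal q *
          ((f t * ENNReal.ofReal (φ t / t)) ^ q * ENNReal.ofReal (t ^ q / q)) := by
        rw [mul_left_comm, ← ENNReal.ofReal_mul hq.le, mul_div_cancel₀ _ hq.ne',
          ← ENNReal.ofReal_rpow_of_pos ht, ← ENNReal.mul_rpow_of_nonneg _ _ hq.le,
          mul_assoc, ← ENNReal.ofReal_mul' ht.le, div_mul_cancel₀ _ ht.ne']
    _ ≤ _ := by gcongr

/-- **Embedding of classical Lorentz spaces `Λ^q_φ ↪ Λ^p_φ` for `1 ≤ q < p < ∞`,**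
with embedding constant `q^{1/q - 1/p}` independent of the quasi-concave function `φ`:
for every nonincreasing `f : (0,∞) → [0,∞]`,
`(∫₀^∞ (f·φ)^p dt/t)^{1/p} ≤ q^{1/q−1/p} (∫₀^∞ (f·φ)^q dt/t)^{1/q}`. -/
theorem lorentz_embedding
    (φ : ℝ → ℝ) (hφ : QuasiConcave φ) (p q : ℝ) (hq : 1 ≤ q) (hqp : q < p)
    (f : ℝ → ℝ≥0∞) (hf : AntitoneOn f (Set.Ioi 0)) :
    (∫⁻ t in Set.Ioi (0 : ℝ),
        (f t * ENNReal.ofReal (φ t)) ^ p * ENNReal.ofReal (1 / t)) ^ (1 / p) ≤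
      ENNReal.ofReal (q ^ (1 / q - 1 / p)) *
        (∫⁻ t in Set.Ioi (0 : ℝ),
          (f t * ENNReal.ofReal (φ t)) ^ q * ENNReal.ofReal (1 / t)) ^ (1 / q) := by
  have hq0 : 0 < q := by linarith
  have hp0 : 0 < p := by linarith
  have hbound := fun t (ht : 0 < t) => rpow_mul_le_lintegral hφ.2.2.2 hq0 hf ht
  set I := ∫⁻ t in Set.Ioi (0 : ℝ),
    (f t * ENNReal.ofReal (φ t)) ^ q * ENNReal.ofReal (1 / t) with hI
  by_cases hIt : I = ⊤
  · rw [hIt, ENNReal.top_rpow_of_pos (by positivity), ENNReal.mul_top]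
    · exact le_top
    · exact (ENNReal.ofReal_pos.2 (by positivity)).ne'
  have hr : 0 ≤ (p - q) / q := div_nonneg (by linarith) hq0.le
  have hmain : ∫⁻ t in Set.Ioi (0 : ℝ),
      (f t * ENNReal.ofReal (φ t)) ^ p * ENNReal.ofReal (1 / t) ≤
      (ENNReal.ofReal q * I) ^ ((p - q) / q) * I := by
    conv_rhs => rw [hI]
    rw [← lintegral_const_mul' _ _
      (ENNReal.rpow_ne_top_of_nonneg hr (ENNReal.mul_ne_top ENNReal.ofReal_ne_top hIt))]
    refine setLIntegral_mono' measurableSet_Ioi fun t ht => ?_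
    have hsplit : (f t * ENNReal.ofReal (φ t)) ^ p =
        ((f t * ENNReal.ofReal (φ t)) ^ q) ^ ((p - q) / q) *
          (f t * ENNReal.ofReal (φ t)) ^ q := by
      rw [← ENNReal.rpow_mul, mul_div_cancel₀ _ hq0.ne',
        ← ENNReal.rpow_add_of_nonneg _ _ (by linarith) hq0.le, sub_add_cancel]
    rw [hsplit, ← mul_assoc]
    gcongr
    exact hbound t ht
  refine (ENNReal.rpow_le_rpow hmain (by positivity)).trans_eq ?_
  have hexp : (p - q) / q * (1 / p) = 1 / q - 1 / p := by field_simp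
  have hexp0 : 0 ≤ 1 / q - 1 / p := hexp ▸ mul_nonneg hr (by positivity)
  rw [ENNReal.mul_rpow_of_nonneg _ _ (by positivity), ← ENNReal.rpow_mul, hexp,
    ENNReal.mul_rpow_of_nonneg _ _ hexp0, mul_assoc,
    ← ENNReal.rpow_add_of_nonneg _ _ hexp0 (by positivity), sub_add_cancel,
    ENNReal.ofReal_rpow_of_pos hq0]
end

section
/- Let (P, d, μ) be a metric measure space where μ is a σ-finite Borel regular measure such that every open ball has finite positive measure, and μ is doubling: there is a constant C_d ≥ 1 with μ(B(x,2r)) ≤ C_d μ(B(x,r)) for all x ∈ P, r > 0. Then there is a constant C > 0, depending only on the doubling constant, such that for every μ-measurable u and every t ∈ (0, μ(P)): (M₁u)*(t) ≤ C · u**(t), where M₁ is the non-centered Hardy–Littlewood maximal operator. -/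
open MeasureTheory
open scoped ENNReal NNReal

/-- The non-centered Hardy–Littlewood-type maximal operator
`M_p u (x) = sup_{B ∋ x} ((1/μ B) ∫_B u^p dμ)^{1/p}`, the supremum being taken over
open balls containing `x`. -/
noncomputable def maximalFn {P : Type*} [PseudoMetricSpace P] [MeasurableSpace P]
    (μ : Measure P) (p : ℝ) (u : P → ℝ≥0∞) (x : P) : ℝ≥0∞ :=
  ⨆ (c : P) (r : ℝ) (_ : 0 < r) (_ : x ∈ Metric.ball c r),
    ((μ (Metric.ball c r))⁻¹ * ∫⁻ z in Metric.ball c r, u z ^ p ∂μ) ^ (1 / p)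

/-- The decreasing rearrangement `u*(t) = inf {s : μ {|u| > s} ≤ t}` of `u` (given here
for the modulus `u : P → [0,∞]` of a measurable function). -/
noncomputable def rearr {P : Type*} [MeasurableSpace P] (μ : Measure P)
    (u : P → ℝ≥0∞) (t : ℝ) : ℝ≥0∞ :=
  sInf {s : ℝ≥0∞ | μ {x | s < u x} ≤ ENNReal.ofReal t}

/-- The elementary maximal function `u**(t) = (1/t) ∫₀^t u*(s) ds`. -/
noncomputable def doubleStar {P : Type*} [MeasurableSpace P] (μ : Measure P)
    (u : P → ℝ≥0∞) (t : ℝ) : ℝ≥0∞ :=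
  (ENNReal.ofReal t)⁻¹ * ∫⁻ s in Set.Ioo (0 : ℝ) t, rearr μ u s

theorem lintegral_eq_lintegral_meas_ofReal_lt {α : Type*} [MeasurableSpace α] (μ : Measure α)
    {f : α → ℝ≥0∞} (hf : Measurable f) :
    ∫⁻ x, f x ∂μ = ∫⁻ s in Set.Ioi (0 : ℝ), μ {x | ENNReal.ofReal s < f x} := by
  by_cases htop : μ {x | f x = ⊤} = 0
  · have hfin : ∀ᵐ x ∂μ, f x ≠ ⊤ := by
      rw [ae_iff]
      simpa using htop
    calc ∫⁻ x, f x ∂μ = ∫⁻ x, ENNReal.ofReal (f x).toReal ∂μ := by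
          refine lintegral_congr_ae ?_
          filter_upwards [hfin] with x hx
          rw [ENNReal.ofReal_toReal hx]
      _ = ∫⁻ s in Set.Ioi (0 : ℝ), μ {x | s < (f x).toReal} :=
          lintegral_eq_lintegral_meas_lt μ (Filter.Eventually.of_forall fun x =>
            ENNReal.toReal_nonneg) hf.ennreal_toReal.aemeasurable
      _ = _ := by
          refine setLIntegral_congr_fun measurableSet_Ioi fun s hs => measure_congr ?_
          filter_upwards [hfin] with x hx
          exact propext (ENNReal.ofReal_lt_iff_lt_toReal (le_of_lt hs) hx).symm
  · have hleft : ∫⁻ x, f x ∂μ = ⊤ := by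
      by_contra h
      exact htop (by simpa [ae_iff] using ae_lt_top hf h)
    rw [hleft, eq_comm, eq_top_iff]
    calc (⊤ : ℝ≥0∞) = ∫⁻ _ in Set.Ioi (0 : ℝ), μ {x | f x = ⊤} := by
          simp [ENNReal.mul_top htop]
      _ ≤ _ := by
          refine lintegral_mono fun s => measure_mono fun x hx => ?_
          have hx' : f x = ⊤ := hx
          simp [hx']

section Rearrangement

variable {P : Type*} [MeasurableSpace P] (μ : Measure P) (u : P → ℝ≥0∞)

theorem rearr_antitone : Antitone (rearr μ u) := fun _ _ hst =>
  sInf_le_sInf fun _ hs => le_trans hs (ENNReal.ofReal_le_ofReal hst)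

theorem measure_rearr_lt_le (t : ℝ) : μ {x | rearr μ u t < u x} ≤ ENNReal.ofReal t := by
  obtain ⟨a, ha, hlim, hmem⟩ :=
    exists_seq_tendsto_sInf (S := {s : ℝ≥0∞ | μ {x | s < u x} ≤ ENNReal.ofReal t})
      ⟨⊤, by simp⟩ (OrderBot.bddBelow _)
  have hmono : Monotone fun n => {x | a n < u x} := fun m n hmn x hx =>
    lt_of_le_of_lt (ha hmn) hx
  calc μ {x | rearr μ u t < u x} ≤ μ (⋃ n, {x | a n < u x}) := by
        refine measure_mono fun x hx => ?_
        obtain ⟨n, hn⟩ := (hlim.eventually_lt_const hx).exists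
        exact Set.mem_iUnion.2 ⟨n, hn⟩
    _ = ⨆ n, μ {x | a n < u x} := hmono.measure_iUnion
    _ ≤ ENNReal.ofReal t := iSup_le hmem

theorem lt_rearr_of_lt_measure {s : ℝ} {a : ℝ≥0∞}
    (h : ENNReal.ofReal s < μ {x | a < u x}) : a < rearr μ u s := by
  by_contra! hle
  exact absurd ((measure_mono fun x hx => lt_of_le_of_lt hle hx).trans (measure_rearr_lt_le μ u s))
    (not_le.2 h)

theorem min_measure_le_volume_lt_rearr (t : ℝ) (a : ℝ≥0∞) :
    min (ENNReal.ofReal t) (μ {x | a < u x}) ≤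
      volume.restrict (Set.Ioo 0 t) {s | a < rearr μ u s} := by
  set m := min (ENNReal.ofReal t) (μ {x | a < u x}) with hm
  have hmtop : m ≠ ⊤ := ne_top_of_le_ne_top ENNReal.ofReal_ne_top (min_le_left _ _)
  have hvol : volume (Set.Ioo 0 m.toReal) = m := by
    rw [Real.volume_Ioo, sub_zero, ENNReal.ofReal_toReal hmtop]
  calc m = volume (Set.Ioo 0 m.toReal) := hvol.symm
    _ ≤ volume ({s | a < rearr μ u s} ∩ Set.Ioo 0 t) := by
        refine measure_mono fun s hs => ?_
        have hsm : ENNReal.ofReal s < m := (ENNReal.ofReal_lt_iff_lt_toReal hs.1.le hmtop).2 hs.2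
        refine ⟨lt_rearr_of_lt_measure μ u (hsm.trans_le (min_le_right _ _)), hs.1, ?_⟩
        exact (ENNReal.ofReal_lt_ofReal_iff_of_nonneg hs.1.le).1 (hsm.trans_le (min_le_left _ _))
    _ ≤ _ := Measure.le_restrict_apply _ _

theorem lintegral_sub_rearr_le (hu : Measurable u) (t : ℝ) :
    ∫⁻ x, (u x - rearr μ u t) ∂μ ≤ ∫⁻ s in Set.Ioo (0 : ℝ) t, rearr μ u s := by
  rw [lintegral_eq_lintegral_meas_ofReal_lt μ (hu.sub_const _),
    lintegral_eq_lintegral_meas_ofReal_lt _ (rearr_antitone μ u).measurable]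
  refine lintegral_mono fun a => le_trans (le_min ?_ ?_) (min_measure_le_volume_lt_rearr μ u t _)
  · refine (measure_mono fun x hx => ?_).trans (measure_rearr_lt_le μ u t)
    have hx' : ENNReal.ofReal a < u x - rearr μ u t := hx
    exact tsub_pos_iff_lt.1 (lt_of_le_of_lt zero_le hx')
  · refine measure_mono fun x hx => ?_
    have hx' : ENNReal.ofReal a < u x - rearr μ u t := hx
    exact hx'.trans_le tsub_le_self

theorem rearr_le_doubleStar {t : ℝ} (ht : 0 < t) : rearr μ u t ≤ doubleStar μ u t := by
  have h0 : ENNReal.ofReal t ≠ 0 := by simpa using ht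
  rw [doubleStar, mul_comm, ← div_eq_mul_inv, ENNReal.le_div_iff_mul_le (Or.inl h0)
    (Or.inl ENNReal.ofReal_ne_top)]
  calc rearr μ u t * ENNReal.ofReal t = ∫⁻ _ in Set.Ioo (0 : ℝ) t, rearr μ u t := by simp
    _ ≤ _ := setLIntegral_mono (rearr_antitone μ u).measurable fun s hs =>
        rearr_antitone μ u hs.2.le

end Rearrangement

section WeakType

variable {P : Type*} [PseudoMetricSpace P] [MeasurableSpace P]

theorem mul_measure_large_average_le [OpensMeasurableSpace P] (μ : Measure P) [SFinite μ] (Cd : ℝ≥0∞)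
    (hpos : ∀ (x : P) (r : ℝ), 0 < r → 0 < μ (Metric.ball x r))
    (hdbl : ∀ (x : P) (r : ℝ), 0 < r → μ (Metric.ball x (2 * r)) ≤ Cd * μ (Metric.ball x r))
    (g : P → ℝ≥0∞) (a : ℝ≥0∞) :
    a * μ {x | ∃ c r, 0 < r ∧ x ∈ Metric.ball c r ∧
      a * μ (Metric.ball c r) < ∫⁻ z in Metric.ball c r, g z ∂μ} ≤ Cd ^ 2 * ∫⁻ z, g z ∂μ := by
  set T : ℕ → Set (P × ℝ) := fun n => {q | 0 < q.2 ∧ q.2 ≤ n ∧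
    a * μ (Metric.ball q.1 q.2) < ∫⁻ z in Metric.ball q.1 q.2, g z ∂μ}
  set E : ℕ → Set P := fun n => ⋃ q ∈ T n, Metric.ball q.1 q.2
  have hmono : Monotone E := fun m n hmn => Set.biUnion_mono
    (fun q hq => ⟨hq.1, hq.2.1.trans (by exact_mod_cast hmn), hq.2.2⟩) fun _ _ => subset_rfl
  have hsub : {x | ∃ c r, 0 < r ∧ x ∈ Metric.ball c r ∧
      a * μ (Metric.ball c r) < ∫⁻ z in Metric.ball c r, g z ∂μ} ⊆ ⋃ n, E n := by
    rintro x ⟨c, r, hr, hx, hlt⟩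
    obtain ⟨n, hn⟩ := exists_nat_ge r
    exact Set.mem_iUnion.2 ⟨n, Set.mem_biUnion (show (c, r) ∈ T n from ⟨hr, hn, hlt⟩) hx⟩
  refine (mul_le_mul_right (measure_mono hsub) a).trans ?_
  rw [hmono.measure_iUnion, ENNReal.mul_iSup]
  refine iSup_le fun n => ?_
  obtain ⟨v, hvT, hdisj, hcov⟩ := Vitali.exists_disjoint_subfamily_covering_enlargement_ball
    (T n) Prod.fst Prod.snd n (fun q hq => hq.2.1) 4 (by norm_num)
  have hv : v.Countable := by
    have hc := Measure.countable_meas_pos_of_disjoint_iUnion (μ := μ)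
      (As := fun q : v => Metric.ball q.1.1 q.1.2) (fun _ => Metric.isOpen_ball.measurableSet)
      (hdisj.subtype _ _)
    exact Set.countable_univ_iff.1
      (hc.mono fun q _ => hpos q.1.1 q.1.2 (hvT q.2).1)
  have : Countable v := hv
  have hball : ∀ q : v, a * μ (Metric.ball q.1.1 (4 * q.1.2)) ≤
      Cd ^ 2 * ∫⁻ z in Metric.ball q.1.1 q.1.2, g z ∂μ := by
    rintro ⟨⟨c, r⟩, hq⟩
    obtain ⟨hr, -, hlt⟩ := hvT hq
    have h4 : μ (Metric.ball c (4 * r)) ≤ Cd ^ 2 * μ (Metric.ball c r) := by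
      calc μ (Metric.ball c (4 * r)) = μ (Metric.ball c (2 * (2 * r))) := by ring_nf
        _ ≤ Cd * (Cd * μ (Metric.ball c r)) := (hdbl c (2 * r) (by positivity)).trans
            (by gcongr; exact hdbl c r hr)
        _ = _ := by ring
    calc a * μ (Metric.ball c (4 * r)) ≤ a * (Cd ^ 2 * μ (Metric.ball c r)) := by gcongr
      _ = Cd ^ 2 * (a * μ (Metric.ball c r)) := by ring
      _ ≤ _ := by gcongr
  calc a * μ (E n) ≤ a * μ (⋃ q : v, Metric.ball q.1.1 (4 * q.1.2)) := by
        gcongr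
        refine Set.iUnion₂_subset fun q hq => ?_
        obtain ⟨b, hb, hqb⟩ := hcov q hq
        exact hqb.trans (Set.subset_iUnion (fun q : v => Metric.ball q.1.1 (4 * q.1.2)) ⟨b, hb⟩)
    _ ≤ a * ∑' q : v, μ (Metric.ball q.1.1 (4 * q.1.2)) := by
        gcongr
        exact measure_iUnion_le _
    _ = ∑' q : v, a * μ (Metric.ball q.1.1 (4 * q.1.2)) := ENNReal.tsum_mul_left.symm
    _ ≤ ∑' q : v, Cd ^ 2 * ∫⁻ z in Metric.ball q.1.1 q.1.2, g z ∂μ := ENNReal.tsum_le_tsum hball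
    _ = Cd ^ 2 * ∫⁻ z in ⋃ q ∈ v, Metric.ball q.1 q.2, g z ∂μ := by
        rw [ENNReal.tsum_mul_left, lintegral_biUnion hv
          (fun _ _ => Metric.isOpen_ball.measurableSet) hdisj]
    _ ≤ _ := by
        gcongr
        exact Measure.restrict_le_self

theorem exists_large_average_of_lt_maximalFn (μ : Measure P)
    (hball : ∀ (x : P) (r : ℝ), 0 < r → 0 < μ (Metric.ball x r) ∧ μ (Metric.ball x r) < ⊤)
    (u : P → ℝ≥0∞) (b a : ℝ≥0∞) {x : P} (hx : b + a < maximalFn μ 1 u x) :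
    ∃ c r, 0 < r ∧ x ∈ Metric.ball c r ∧
      a * μ (Metric.ball c r) < ∫⁻ z in Metric.ball c r, (u z - b) ∂μ := by
  simp only [maximalFn, lt_iSup_iff, ENNReal.rpow_one, div_one] at hx
  obtain ⟨c, r, hr, hxc, hlt⟩ := hx
  refine ⟨c, r, hr, hxc, ?_⟩
  by_contra! hle
  obtain ⟨hp, hf⟩ := hball c r hr
  refine absurd ((ENNReal.inv_mul_le_iff hp.ne' hf.ne).2 ?_) (not_le.2 hlt)
  calc ∫⁻ z in Metric.ball c r, u z ∂μ ≤ ∫⁻ z in Metric.ball c r, (b + (u z - b)) ∂μ :=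
        lintegral_mono fun z => le_add_tsub
    _ = b * μ (Metric.ball c r) + ∫⁻ z in Metric.ball c r, (u z - b) ∂μ := by
        rw [lintegral_add_left measurable_const, setLIntegral_const]
    _ ≤ b * μ (Metric.ball c r) + a * μ (Metric.ball c r) := by gcongr
    _ = _ := by ring

end WeakType

/-- **Riesz's half of the Herz–Riesz inequality:** on any metric measure space with a
σ-finite Borel regular doubling measure giving balls finite positive measure, there is a
constant `C > 0` depending only on the doubling constant such that
`(M₁ u)*(t) ≤ C · u**(t)` for all measurable `u` and all `t ∈ (0, μ(P))`. -/
theorem rearrangement_maximal_le_doubleStar (Cd : ℝ≥0) (hCd : 1 ≤ Cd) :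
    ∃ C : ℝ, 0 < C ∧
      ∀ (P : Type) [MetricSpace P] [MeasurableSpace P] [BorelSpace P]
        (μ : Measure P), SigmaFinite μ →
        (∀ (x : P) (r : ℝ), 0 < r →
          0 < μ (Metric.ball x r) ∧ μ (Metric.ball x r) < ⊤) →
        (∀ (x : P) (r : ℝ), 0 < r →
          μ (Metric.ball x (2 * r)) ≤ (Cd : ℝ≥0∞) * μ (Metric.ball x r)) →
        ∀ u : P → ℝ≥0∞, Measurable u →
          ∀ t : ℝ, 0 < t → ENNReal.ofReal t < μ Set.univ →
            rearr μ (maximalFn μ 1 u) t ≤ ENNReal.ofReal C * doubleStar μ u t := by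
  refine ⟨1 + (Cd : ℝ) ^ 2, by positivity, ?_⟩
  intro P _ _ _ μ hσ hball hdbl u hu t ht _
  have hC : ENNReal.ofReal (1 + (Cd : ℝ) ^ 2) = 1 + (Cd : ℝ≥0∞) ^ 2 := by
    rw [ENNReal.ofReal_add zero_le_one (by positivity), ENNReal.ofReal_one,
      ENNReal.ofReal_pow Cd.coe_nonneg, ENNReal.ofReal_coe_nnreal]
  rw [hC, add_mul, one_mul]
  refine ENNReal.le_of_forall_pos_le_add fun ε hε hfin => ?_
  set A := doubleStar μ u t with hA
  set a : ℝ≥0∞ := (Cd : ℝ≥0∞) ^ 2 * A + ε with ha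
  have hatop : a ≠ ⊤ := ENNReal.add_ne_top.2
    ⟨ne_top_of_le_ne_top hfin.ne le_add_self, ENNReal.coe_ne_top⟩
  have ha0 : a ≠ 0 := by
    have : (ε : ℝ≥0∞) ≠ 0 := by exact_mod_cast hε.ne'
    simp [ha, this]
  have hint : ∫⁻ x, (u x - rearr μ u t) ∂μ ≤ ENNReal.ofReal t * A := by
    refine (lintegral_sub_rearr_le μ u hu t).trans_eq ?_
    rw [hA, doubleStar, ← mul_assoc, ENNReal.mul_inv_cancel (by simpa using ht)
      ENNReal.ofReal_ne_top, one_mul]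
  rw [add_assoc]
  refine sInf_le ?_
  refine (ENNReal.mul_le_mul_iff_right ha0 hatop).1 ?_
  calc a * μ {x | A + a < maximalFn μ 1 u x}
      ≤ a * μ {x | ∃ c r, 0 < r ∧ x ∈ Metric.ball c r ∧ a * μ (Metric.ball c r) <
          ∫⁻ z in Metric.ball c r, (u z - rearr μ u t) ∂μ} := by
        gcongr with x
        intro hx
        refine exists_large_average_of_lt_maximalFn μ hball u _ a (lt_of_le_of_lt ?_ hx)
        gcongr
        exact rearr_le_doubleStar μ u ht
    _ ≤ (Cd : ℝ≥0∞) ^ 2 * ∫⁻ x, (u x - rearr μ u t) ∂μ :=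
        mul_measure_large_average_le μ Cd (fun x r hr => (hball x r hr).1) hdbl _ a
    _ ≤ (Cd : ℝ≥0∞) ^ 2 * (ENNReal.ofReal t * A) := by gcongr
    _ = (Cd : ℝ≥0∞) ^ 2 * A * ENNReal.ofReal t := by ring
    _ ≤ a * ENNReal.ofReal t := by
        gcongr
        exact le_self_add
end

section
/- Let (P, d, μ) be a metric measure space where μ is a σ-finite non-atomic Borel regular measure such that every open ball has finite positive measure, and μ is doubling. Let p ∈ [1,∞) and let ‖·‖ be a functional on μ-measurable functions satisfying: the lattice property (|u| ≤ |v| a.e. implies ‖u‖ ≤ ‖v‖); homogeneity ‖a·u‖ = |a|·‖u‖; absolute continuity (for every u with ‖u‖ < ∞, ‖u·χ_{E_n}‖ → 0 whenever (E_n) decreases with μ(⋂_n E_n) = 0); every u with ‖u‖ < ∞ satisfies ∫_E |u|^p dμ < ∞ for all E with μ(E) < ∞; and for every measurable E with μ(E) < ∞ there is c_E > 0 such that ‖(M_p u)·χ_E‖ ≤ c_E ‖u‖ for all measurable u. Then for every v with ‖v‖ < ∞: ‖σ·χ_{{x : M_p v(x) > σ}}‖ → 0 as σ → ∞. -/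
open MeasureTheory
open scoped ENNReal NNReal

open Filter Set Metric
open scoped Topology

/-- A disjoint family of closed balls of positive radius is countable when balls have positive
measure for a σ-finite measure. -/
lemma countable_of_pairwiseDisjoint_closedBall
    {P ι : Type*} [PseudoMetricSpace P] [MeasurableSpace P] [BorelSpace P]
    (μ : Measure P) [SigmaFinite μ]
    (hpos : ∀ (x : P) (r : ℝ), 0 < r → 0 < μ (ball x r))
    {t : Set ι} {x : ι → P} {r : ι → ℝ} (hr : ∀ i ∈ t, 0 < r i)
    (hd : t.PairwiseDisjoint fun i => closedBall (x i) (r i)) : t.Countable := by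
  have key := Measure.countable_meas_pos_of_disjoint_iUnion (μ := μ)
    (As := fun i : t => closedBall (x i) (r i)) (fun i => measurableSet_closedBall)
    (fun i j hij => hd i.2 j.2 fun h => hij (Subtype.ext h))
  have huniv : {i : t | 0 < μ (closedBall (x i) (r i))} = univ :=
    eq_univ_of_forall fun i => (hpos _ _ (hr i i.2)).trans_le (measure_mono ball_subset_closedBall)
  rw [huniv, countable_univ_iff] at key
  exact countable_coe_iff.1 key

/-- In a metric space with a σ-finite measure without atoms which gives every ball finite positive
measure, the space is covered by countably many sets of arbitrarily small measure. -/
lemma exists_seq_cover_measure_le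
    {P : Type*} [MetricSpace P] [MeasurableSpace P] [BorelSpace P]
    (μ : Measure P) [SigmaFinite μ] [NullSingletonClass μ]
    (hball : ∀ (x : P) (r : ℝ), 0 < r → 0 < μ (ball x r) ∧ μ (ball x r) < ⊤)
    {ε : ℝ≥0∞} (hε : 0 < ε) :
    ∃ B : ℕ → Set P, (∀ n, MeasurableSet (B n)) ∧ (∀ n, μ (B n) ≤ ε) ∧ ⋃ n, B n = univ := by
  have hsmall : ∀ x : P, ∃ r : ℝ, 0 < r ∧ r ≤ 1 ∧ μ (closedBall x (5 * r)) ≤ ε := by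
    intro x
    have hlim := tendsto_measure_cthickening_of_isClosed (μ := μ) (s := {x})
      ⟨1 / 2, by norm_num, ne_top_of_le_ne_top (hball x 1 one_pos).2.ne (measure_mono (by
        rw [cthickening_singleton _ (by norm_num)]
        exact closedBall_subset_ball (by norm_num)))⟩ isClosed_singleton
    rw [measure_singleton] at hlim
    have hev := (hlim.eventually (gt_mem_nhds hε)).filter_mono
      (nhdsWithin_le_nhds (s := Ioi (0 : ℝ)))
    have hle : ∀ᶠ r : ℝ in 𝓝[>] 0, r ≤ 5 :=
      nhdsWithin_le_nhds (Iic_mem_nhds (by norm_num))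
    obtain ⟨r, ⟨hr, hr5⟩, hr0⟩ := ((hev.and hle).and self_mem_nhdsWithin).exists
    have hr0 : 0 < r := hr0
    refine ⟨r / 5, by positivity, by linarith, ?_⟩
    rw [cthickening_singleton _ hr0.le] at hr
    rw [mul_div_cancel₀ r (by norm_num : (5 : ℝ) ≠ 0)]
    exact hr.le
  choose r hr0 hr1 hrε using hsmall
  obtain ⟨u, -, hd, hcov⟩ := Vitali.exists_disjoint_subfamily_covering_enlargement_closedBall
    (univ : Set P) id r 1 (fun a _ => hr1 a) 5 (by norm_num)
  have hu : u.Countable := countable_of_pairwiseDisjoint_closedBall μ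
    (fun x r h => (hball x r h).1) (fun i _ => hr0 i) hd
  rcases u.eq_empty_or_nonempty with rfl | hne
  · refine ⟨fun _ => ∅, by simp, by simp, eq_univ_of_forall fun x => ?_⟩
    obtain ⟨b, hb, -⟩ := hcov x (mem_univ x)
    exact hb.elim
  · obtain ⟨f, rfl⟩ := hu.exists_eq_range hne
    refine ⟨fun n => closedBall (f n) (5 * r (f n)), fun n => measurableSet_closedBall,
      fun n => hrε _, eq_univ_of_forall fun x => ?_⟩
    obtain ⟨-, ⟨n, rfl⟩, hb⟩ := hcov x (mem_univ x)
    exact mem_iUnion.2 ⟨n, hb (mem_closedBall_self (hr0 x).le)⟩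

/-- If countably many sets of measure at most `ε` cover the space, then every set of infinite
measure contains a subset of measure between `ε` and `2 * ε`. -/
lemma exists_subset_measure_le_two_mul
    {P : Type*} [MeasurableSpace P] (μ : Measure P) {ε : ℝ≥0∞} (hε : ε < ⊤)
    {B : ℕ → Set P} (hBm : ∀ n, MeasurableSet (B n)) (hBε : ∀ n, μ (B n) ≤ ε)
    (hB : ⋃ n, B n = univ) {S : Set P} (hS : MeasurableSet S) (hSμ : μ S = ⊤) :
    ∃ A ⊆ S, MeasurableSet A ∧ ε ≤ μ A ∧ μ A ≤ 2 * ε := by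
  classical
  have hmono : Monotone fun n => S ∩ ⋃ i ∈ Finset.range n, B i := fun m n hmn =>
    inter_subset_inter_right _ (biUnion_subset_biUnion_left (by simpa using hmn))
  have hunion : ⋃ n, S ∩ ⋃ i ∈ Finset.range n, B i = S := by
    rw [← inter_iUnion, inter_eq_left]
    intro x _
    obtain ⟨n, hn⟩ := mem_iUnion.1 (hB.symm ▸ mem_univ x : x ∈ ⋃ n, B n)
    exact mem_iUnion.2 ⟨n + 1, mem_biUnion (x := n) (by simp) hn⟩
  have hex : ∃ n, ε ≤ μ (S ∩ ⋃ i ∈ Finset.range n, B i) := by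
    have h := hmono.measure_iUnion (μ := μ)
    rw [hunion, hSμ] at h
    obtain ⟨n, hn⟩ := lt_iSup_iff.1 (h ▸ hε)
    exact ⟨n, hn.le⟩
  refine ⟨_, inter_subset_left, hS.inter (Finset.measurableSet_biUnion _ fun i _ => hBm i),
    Nat.find_spec hex, ?_⟩
  obtain hn | ⟨m, hm⟩ : Nat.find hex = 0 ∨ ∃ m, Nat.find hex = m + 1 :=
    Nat.eq_zero_or_eq_succ_pred _ |>.imp_right fun h => ⟨_, h⟩
  · rw [hn]; simp
  · have hlt := not_le.1 (Nat.find_min hex (m.lt_succ_self.trans_eq hm.symm))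
    rw [hm, Finset.range_add_one, Finset.set_biUnion_insert, inter_union_distrib_left, two_mul]
    exact (measure_union_le _ _).trans
      (add_le_add ((measure_mono inter_subset_right).trans (hBε m)) hlt.le)

/-- A function which is `p`-integrable on all sets of finite measure of a non-atomic space is
`p`-integrable above some level. -/
lemma exists_setLIntegral_rpow_superlevel_lt_top
    {P : Type*} [MetricSpace P] [MeasurableSpace P] [BorelSpace P]
    (μ : Measure P) [SigmaFinite μ] [NullSingletonClass μ]
    (hball : ∀ (x : P) (r : ℝ), 0 < r → 0 < μ (ball x r) ∧ μ (ball x r) < ⊤)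
    {p : ℝ} (hp : 1 ≤ p) {v : P → ℝ≥0∞} (hv : Measurable v)
    (hLp : ∀ E : Set P, MeasurableSet E → μ E < ⊤ → ∫⁻ x in E, v x ^ p ∂μ < ⊤) :
    ∃ K : ℝ≥0, ∫⁻ x in {x | (K : ℝ≥0∞) < v x}, v x ^ p ∂μ < ⊤ := by
  by_contra! hcon
  have hmeas : ∀ K : ℝ≥0, MeasurableSet {x | (K : ℝ≥0∞) < v x} := fun K =>
    measurableSet_lt measurable_const hv
  have hinf : ∀ K : ℝ≥0, μ {x | (K : ℝ≥0∞) < v x} = ⊤ := fun K => by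
    by_contra h
    exact (hLp _ (hmeas K) (lt_top_iff_ne_top.2 h)).not_ge (hcon K)
  have hA : ∀ j : ℕ, ∃ A ⊆ {x | (((4 : ℝ≥0) ^ j : ℝ≥0) : ℝ≥0∞) < v x}, MeasurableSet A ∧
      2⁻¹ ^ j ≤ μ A ∧ μ A ≤ 2 * 2⁻¹ ^ j := by
    intro j
    have hε : (0 : ℝ≥0∞) < 2⁻¹ ^ j := ENNReal.pow_pos (by simp) j
    obtain ⟨B, hBm, hBε, hB⟩ := exists_seq_cover_measure_le μ hball hε
    exact exists_subset_measure_le_two_mul μ (by finiteness) hBm hBε hB (hmeas _) (hinf _)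
  choose A hAsub hAm hAlow hAup using hA
  have hfin : μ (⋃ j, A j) < ⊤ := by
    refine (measure_iUnion_le _).trans_lt ((ENNReal.tsum_le_tsum hAup).trans_lt ?_)
    rw [ENNReal.tsum_mul_left, ENNReal.tsum_geometric, ENNReal.one_sub_inv_two, inv_inv]
    finiteness
  refine (hLp _ (MeasurableSet.iUnion hAm) hfin).ne
    (ENNReal.eq_top_of_forall_nnreal_le fun C => ?_)
  obtain ⟨j, hj⟩ := pow_unbounded_of_one_lt C (one_lt_two : (1 : ℝ≥0) < 2)
  calc (C : ℝ≥0∞) ≤ 2 ^ j := by exact_mod_cast hj.le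
    _ = 4 ^ j * 2⁻¹ ^ j := by
      rw [← mul_pow, show (4 : ℝ≥0∞) = 2 * 2 by norm_num, mul_assoc,
        ENNReal.mul_inv_cancel (by simp) (by simp), mul_one]
    _ ≤ 4 ^ j * μ (A j) := by gcongr; exact hAlow j
    _ = ∫⁻ _ in A j, 4 ^ j ∂μ := by simp
    _ ≤ ∫⁻ x in A j, v x ^ p ∂μ := by
      refine setLIntegral_mono' (hAm j) fun x hx => ?_
      have hx4 : (4 : ℝ≥0∞) ^ j ≤ v x := by
        have := hAsub j hx
        simp only [mem_ofPred_eq, ENNReal.coe_pow, ENNReal.coe_ofNat] at this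
        exact this.le
      refine hx4.trans (ENNReal.le_rpow_self_of_one_le (le_trans ?_ hx4) hp)
      exact one_le_pow₀ (by norm_num)
    _ ≤ ∫⁻ x in ⋃ j, A j, v x ^ p ∂μ := lintegral_mono_set (subset_iUnion A j)

/-- The weak type estimate for the uncentered maximal operator of a doubling measure. -/
lemma mul_measure_le_lintegral_of_doubling
    {P : Type*} [PseudoMetricSpace P] [MeasurableSpace P] [BorelSpace P]
    (μ : Measure P) [SigmaFinite μ]
    (hpos : ∀ (x : P) (r : ℝ), 0 < r → 0 < μ (ball x r))
    {C : ℝ≥0∞} (hdbl : ∀ (x : P) (r : ℝ), 0 < r → μ (ball x (2 * r)) ≤ C * μ (ball x r))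
    (f : P → ℝ≥0∞) (a : ℝ≥0∞) :
    a * μ {x | ∃ (c : P) (r : ℝ), 0 < r ∧ x ∈ ball c r ∧
      a * μ (ball c r) ≤ ∫⁻ z in ball c r, f z ∂μ} ≤ C ^ 3 * ∫⁻ z, f z ∂μ := by
  set T : ℕ → Set (P × ℝ) := fun n => {b | 0 < b.2 ∧ b.2 ≤ n ∧
    a * μ (ball b.1 b.2) ≤ ∫⁻ z in ball b.1 b.2, f z ∂μ} with hT
  have hunion : {x | ∃ (c : P) (r : ℝ), 0 < r ∧ x ∈ ball c r ∧
      a * μ (ball c r) ≤ ∫⁻ z in ball c r, f z ∂μ} = ⋃ n, ⋃ b ∈ T n, ball b.1 b.2 := by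
    ext x
    simp only [mem_ofPred_eq, mem_iUnion, hT]
    constructor
    · rintro ⟨c, r, hr, hx, h⟩
      obtain ⟨n, hn⟩ := exists_nat_ge r
      exact ⟨n, (c, r), ⟨hr, hn, h⟩, hx⟩
    · rintro ⟨n, b, ⟨hr, -, h⟩, hx⟩
      exact ⟨b.1, b.2, hr, hx, h⟩
  have hmono : Monotone fun n => ⋃ b ∈ T n, ball b.1 b.2 := fun m n hmn =>
    biUnion_subset_biUnion_left fun b hb => ⟨hb.1, hb.2.1.trans (by exact_mod_cast hmn), hb.2.2⟩
  rw [hunion, hmono.measure_iUnion, ENNReal.mul_iSup]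
  refine iSup_le fun n => ?_
  obtain ⟨u, huT, hd, hcov⟩ := Vitali.exists_disjoint_subfamily_covering_enlargement_closedBall
    (T n) Prod.fst Prod.snd n (fun b hb => hb.2.1) 5 (by norm_num)
  have hu : u.Countable := countable_of_pairwiseDisjoint_closedBall μ hpos
    (fun b hb => (huT hb).1) hd
  have hC : ∀ b ∈ u, μ (closedBall b.1 (5 * b.2)) ≤ C ^ 3 * μ (ball b.1 b.2) := by
    intro b hb
    have hb0 : 0 < b.2 := (huT hb).1
    calc μ (closedBall b.1 (5 * b.2)) ≤ μ (ball b.1 (2 * (2 * (2 * b.2)))) :=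
          measure_mono (closedBall_subset_ball (by linarith))
      _ ≤ C * (C * (C * μ (ball b.1 b.2))) :=
        (hdbl _ _ (by positivity)).trans <| mul_le_mul_right ((hdbl _ _ (by positivity)).trans <|
          mul_le_mul_right (hdbl _ _ hb0) _) _
      _ = C ^ 3 * μ (ball b.1 b.2) := by ring
  have hsub : ⋃ b ∈ T n, ball b.1 b.2 ⊆ ⋃ b ∈ u, closedBall b.1 (5 * b.2) := by
    refine iUnion₂_subset fun b hb => ?_
    obtain ⟨b', hb', h⟩ := hcov b hb
    exact (ball_subset_closedBall.trans h).trans (subset_biUnion_of_mem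
      (u := fun b : P × ℝ => closedBall b.1 (5 * b.2)) hb')
  calc a * μ (⋃ b ∈ T n, ball b.1 b.2)
      ≤ a * ∑' b : u, C ^ 3 * μ (ball b.1.1 b.1.2) := by
        gcongr
        exact (measure_mono hsub).trans ((measure_biUnion_le μ hu _).trans
          (ENNReal.tsum_le_tsum fun b => hC b b.2))
    _ = C ^ 3 * ∑' b : u, a * μ (ball b.1.1 b.1.2) := by
        rw [ENNReal.tsum_mul_left, ENNReal.tsum_mul_left]; ring
    _ ≤ C ^ 3 * ∑' b : u, ∫⁻ z in ball b.1.1 b.1.2, f z ∂μ := by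
        gcongr with b
        exact (huT b.2).2.2
    _ = C ^ 3 * ∫⁻ z in ⋃ b ∈ u, ball b.1 b.2, f z ∂μ := by
        rw [lintegral_biUnion hu (fun _ _ => measurableSet_ball)
          (hd.mono fun _ => ball_subset_closedBall)]
    _ ≤ C ^ 3 * ∫⁻ z, f z ∂μ := by
        gcongr
        exact Measure.restrict_le_self

lemma lowerSemicontinuous_maximalFn {P : Type*} [PseudoMetricSpace P] [MeasurableSpace P]
    (μ : Measure P) (p : ℝ) (u : P → ℝ≥0∞) : LowerSemicontinuous (maximalFn μ p u) := by
  intro x a ha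
  simp only [maximalFn, lt_iSup_iff] at ha
  obtain ⟨c, r, hr, hx, h⟩ := ha
  filter_upwards [isOpen_ball.mem_nhds hx] with y hy
  simp only [maximalFn, lt_iSup_iff]
  exact ⟨c, r, hr, hy, h⟩

/-- Where the maximal function is large, there is a ball on which the average of `v ^ p`
restricted to a superlevel set of `v` is large. -/
lemma exists_ball_of_lt_maximalFn
    {P : Type*} [PseudoMetricSpace P] [MeasurableSpace P]
    (μ : Measure P)
    (hball : ∀ (x : P) (r : ℝ), 0 < r → 0 < μ (ball x r) ∧ μ (ball x r) < ⊤)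
    {p : ℝ} (hp : 0 < p) {v : P → ℝ≥0∞} (hv : Measurable v) (K a : ℝ≥0) {x : P}
    (hx : ((a + K ^ p : ℝ≥0) : ℝ≥0∞) ^ (1 / p) < maximalFn μ p v x) :
    ∃ (c : P) (r : ℝ), 0 < r ∧ x ∈ ball c r ∧ a * μ (ball c r) ≤
      ∫⁻ z in ball c r, {z | (K : ℝ≥0∞) < v z}.indicator (fun z => v z ^ p) z ∂μ := by
  simp only [maximalFn, lt_iSup_iff] at hx
  obtain ⟨c, r, hr, hx, h⟩ := hx
  refine ⟨c, r, hr, hx, ?_⟩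
  obtain ⟨h0, ht⟩ := hball c r hr
  have hK : MeasurableSet {z | (K : ℝ≥0∞) < v z} := measurableSet_lt measurable_const hv
  have h1 := (ENNReal.rpow_lt_rpow_iff (by positivity)).1 h
  rw [mul_comm, ← div_eq_mul_inv, ENNReal.lt_div_iff_mul_lt (Or.inl h0.ne') (Or.inl ht.ne)] at h1
  have h2 : ∫⁻ z in ball c r, v z ^ p ∂μ ≤
      (∫⁻ z in ball c r, {z | (K : ℝ≥0∞) < v z}.indicator (fun z => v z ^ p) z ∂μ)
        + (K : ℝ≥0∞) ^ p * μ (ball c r) := by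
    rw [← setLIntegral_const, ← lintegral_add_right _ measurable_const]
    refine lintegral_mono fun z => ?_
    by_cases hz : (K : ℝ≥0∞) < v z
    · simp [hz]
    · simpa [hz] using ENNReal.rpow_le_rpow (not_lt.1 hz) hp.le
  have h3 := h1.le.trans h2
  rw [ENNReal.coe_add, add_mul, ENNReal.coe_rpow_of_nonneg _ hp.le] at h3
  exact (ENNReal.add_le_add_iff_right (by finiteness)).1 h3

/-- **Weak type estimate from boundedness of the maximal operator:** if a quasi-norm
functional `N` on μ-measurable functions has the lattice property, is homogeneous, is
absolutely continuous, its finiteness implies local `p`-integrability, and the maximal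
operator `M_p` maps `N`-finite functions boundedly into `N` on each set of finite
measure, then `‖σ·χ_{{M_p v > σ}}‖ → 0` as `σ → ∞` for every `v` with `N v < ∞`.
(Here `μ` is a σ-finite non-atomic Borel regular doubling measure on a metric space,
giving every ball finite positive measure.) -/
theorem weak_estimate_of_maximal_bounded
    {P : Type*} [MetricSpace P] [MeasurableSpace P] [BorelSpace P]
    (μ : Measure P) [SigmaFinite μ]
    (hball : ∀ (x : P) (r : ℝ), 0 < r →
      0 < μ (Metric.ball x r) ∧ μ (Metric.ball x r) < ⊤)
    (hna : ∀ s : Set P, MeasurableSet s → 0 < μ s →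
      ∃ t, t ⊆ s ∧ MeasurableSet t ∧ 0 < μ t ∧ μ t < μ s)
    (Cd : ℝ≥0) (hCd : 1 ≤ Cd)
    (hdbl : ∀ (x : P) (r : ℝ), 0 < r →
      μ (Metric.ball x (2 * r)) ≤ (Cd : ℝ≥0∞) * μ (Metric.ball x r))
    (p : ℝ) (hp : 1 ≤ p)
    (N : (P → ℝ≥0∞) → ℝ≥0∞)
    (hlattice : ∀ u v : P → ℝ≥0∞, Measurable u → Measurable v →
      (∀ᵐ x ∂μ, u x ≤ v x) → N u ≤ N v)
    (hhomog : ∀ (a : ℝ≥0) (u : P → ℝ≥0∞), N (fun x => (a : ℝ≥0∞) * u x) = a * N u)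
    (hAC : ∀ u : P → ℝ≥0∞, Measurable u → N u < ⊤ →
      ∀ E : ℕ → Set P, (∀ n, MeasurableSet (E n)) → (∀ n, E (n + 1) ⊆ E n) →
        μ (⋂ n, E n) = 0 →
        Filter.Tendsto (fun n => N ((E n).indicator u)) Filter.atTop (nhds 0))
    (hLp : ∀ u : P → ℝ≥0∞, Measurable u → N u < ⊤ →
      ∀ E : Set P, MeasurableSet E → μ E < ⊤ → ∫⁻ x in E, u x ^ p ∂μ < ⊤)
    (hMbdd : ∀ E : Set P, MeasurableSet E → μ E < ⊤ → ∃ c : ℝ≥0, 0 < c ∧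
      ∀ u : P → ℝ≥0∞, Measurable u →
        N (E.indicator (maximalFn μ p u)) ≤ (c : ℝ≥0∞) * N u)
    (v : P → ℝ≥0∞) (hv : Measurable v) (hNv : N v < ⊤) :
    Filter.Tendsto
      (fun σ : ℝ =>
        N ({x | ENNReal.ofReal σ < maximalFn μ p v x}.indicator
          fun _ => ENNReal.ofReal σ))
      Filter.atTop (nhds 0) := by
  have : NullSingletonClass μ := ⟨fun x => by
    by_contra h
    obtain ⟨t, hts, -, ht0, htx⟩ := hna {x} (measurableSet_singleton x) (pos_iff_ne_zero.2 h)
    rcases subset_singleton_iff_eq.1 hts with rfl | rfl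
    · simp at ht0
    · exact htx.false⟩
  have hp0 : 0 < p := one_pos.trans_le hp
  obtain ⟨K, hK⟩ := exists_setLIntegral_rpow_superlevel_lt_top μ hball hp hv (hLp v hv hNv)
  rw [← lintegral_indicator (measurableSet_lt measurable_const hv)] at hK
  set I := (Cd : ℝ≥0∞) ^ 3 *
    ∫⁻ z, {z | (K : ℝ≥0∞) < v z}.indicator (fun z => v z ^ p) z ∂μ
  have hI_top : I < ⊤ := ENNReal.mul_lt_top (by finiteness) hK
  have hweak : ∀ a : ℝ≥0,
      a * μ {x | ((a + K ^ p : ℝ≥0) : ℝ≥0∞) ^ (1 / p) < maximalFn μ p v x} ≤ I := fun a =>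
    (mul_le_mul_right (measure_mono fun x hx =>
      exists_ball_of_lt_maximalFn μ hball hp0 hv K a hx) _).trans
      (mul_measure_le_lintegral_of_doubling μ (fun x r h => (hball x r h).1) hdbl _ a)
  have hMmeas : Measurable (maximalFn μ p v) := (lowerSemicontinuous_maximalFn μ p v).measurable
  have hlevel : ∀ s : ℝ≥0∞, MeasurableSet {x | s < maximalFn μ p v x} := fun s =>
    measurableSet_lt measurable_const hMmeas
  have hMtop : μ {x | maximalFn μ p v x = ⊤} = 0 := by
    have hle : ∀ a : ℝ≥0, a * μ {x | maximalFn μ p v x = ⊤} ≤ I := fun a =>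
      (mul_le_mul_right (measure_mono fun x (hx : _ = ⊤) => by
        rw [mem_ofPred_eq, hx]
        exact ENNReal.rpow_lt_top_of_nonneg (by positivity) ENNReal.coe_ne_top) _).trans (hweak a)
    by_contra h0
    obtain ⟨n, hn⟩ := ENNReal.exists_nat_mul_gt h0 hI_top.ne
    exact hn.not_ge (by simpa using hle n)
  set s₀ : ℝ≥0∞ := ((1 + K ^ p : ℝ≥0) : ℝ≥0∞) ^ (1 / p)
  have hs₀_top : s₀ ≠ ⊤ := (ENNReal.rpow_lt_top_of_nonneg (by positivity) ENNReal.coe_ne_top).ne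
  set E := {x | s₀ < maximalFn μ p v x}
  have hEfin : μ E < ⊤ := by
    have := (hweak 1).trans_lt hI_top
    rwa [ENNReal.coe_one, one_mul] at this
  obtain ⟨c, -, hc⟩ := hMbdd E (hlevel _) hEfin
  have hNfin : N (E.indicator (maximalFn μ p v)) < ⊤ :=
    (hc v hv).trans_lt (ENNReal.mul_lt_top ENNReal.coe_lt_top hNv)
  have hlim := hAC _ (hMmeas.indicator (hlevel _)) hNfin
    (fun n : ℕ => {x | (n : ℝ≥0∞) < maximalFn μ p v x}) (fun n => hlevel _)
    (fun n x hx => lt_of_le_of_lt (Nat.cast_le.2 n.le_succ) (mem_ofPred_eq ▸ hx))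
    (measure_mono_null (fun x hx => by
      refine ENNReal.eq_top_of_forall_nnreal_le fun a => ?_
      obtain ⟨n, hn⟩ := exists_nat_ge a
      exact (by exact_mod_cast hn : (a : ℝ≥0∞) ≤ n).trans (mem_iInter.1 hx n).le) hMtop)
  refine tendsto_of_tendsto_of_tendsto_of_le_of_le' tendsto_const_nhds
    (hlim.comp (tendsto_nat_floor_atTop (α := ℝ))) (Eventually.of_forall fun _ => zero_le) ?_
  filter_upwards [eventually_ge_atTop s₀.toReal, eventually_ge_atTop 0] with σ hσ hσ0
  refine hlattice _ _ (measurable_const.indicator (hlevel _))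
    ((hMmeas.indicator (hlevel _)).indicator (hlevel _)) (Eventually.of_forall fun x => ?_)
  refine indicator_apply_le' (fun hx => ?_) fun _ => zero_le
  have hx : ENNReal.ofReal σ < maximalFn μ p v x := hx
  have hxE : x ∈ E := lt_of_le_of_lt ((ENNReal.le_ofReal_iff_toReal_le hs₀_top hσ0).2 hσ) hx
  have hxn : x ∈ {x | ((⌊σ⌋₊ : ℕ) : ℝ≥0∞) < maximalFn μ p v x} := by
    refine lt_of_le_of_lt ?_ hx
    rw [← ENNReal.ofReal_natCast]
    exact ENNReal.ofReal_le_ofReal (Nat.floor_le hσ0)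
  rw [indicator_of_mem hxn, indicator_of_mem hxE]
  exact hx.le
end

section
/- Let φ be quasi-concave and p ∈ [1,∞). Define ψ : [0,∞) → [0,∞) by ψ(0) = 0, ψ(t) = t^{1/p} · sup_{t ≤ s ≤ 1} φ(s)/s^{1/p} for 0 < t ≤ 1, and ψ(t) = φ(t) for t ≥ 1. Then ψ^p is quasi-concave on [0,1): ψ(t) > 0 for t ∈ (0,1), t ↦ ψ(t)^p is nondecreasing on [0,1), and t ↦ ψ(t)^p/t is nonincreasing on (0,1). -/
open MeasureTheory
open scoped ENNReal

/-- The quotients `φ s / s ^ q` over `s ∈ [t, 1]`, whose supremum defines the majorant. -/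
def majorantQuotients (φ : ℝ → ℝ) (q t : ℝ) : Set ℝ :=
  {y : ℝ | ∃ s : ℝ, t ≤ s ∧ s ≤ 1 ∧ y = φ s / s ^ q}

theorem QuasiConcave.bddAbove_majorantQuotients {φ : ℝ → ℝ} (hφ : QuasiConcave φ) {q t : ℝ}
    (hq : 0 ≤ q) (ht : 0 < t) : BddAbove (majorantQuotients φ q t) := by
  obtain ⟨-, hpos, hmono, -⟩ := hφ
  refine ⟨φ 1 / t ^ q, ?_⟩
  rintro y ⟨s, hts, hs1, rfl⟩
  have hs : 0 < s := ht.trans_le hts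
  exact div_le_div₀ (hpos 1 one_pos).le (hmono hs.le (Set.mem_Ici.2 zero_le_one) hs1)
    (Real.rpow_pos_of_pos ht q) (Real.rpow_le_rpow ht.le hts hq)

theorem QuasiConcave.le_sSup_majorantQuotients {φ : ℝ → ℝ} (hφ : QuasiConcave φ) {q t s : ℝ}
    (hq : 0 ≤ q) (ht : 0 < t) (hts : t ≤ s) (hs : s ≤ 1) :
    φ s / s ^ q ≤ sSup (majorantQuotients φ q t) :=
  le_csSup (hφ.bddAbove_majorantQuotients hq ht) ⟨s, hts, hs, rfl⟩

theorem QuasiConcave.sSup_majorantQuotients_pos {φ : ℝ → ℝ} (hφ : QuasiConcave φ) {q t : ℝ}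
    (hq : 0 ≤ q) (ht : 0 < t) (ht1 : t ≤ 1) : 0 < sSup (majorantQuotients φ q t) :=
  (div_pos (hφ.2.1 t ht) (Real.rpow_pos_of_pos ht q)).trans_le
    (hφ.le_sSup_majorantQuotients hq ht le_rfl ht1)

theorem QuasiConcave.sSup_majorantQuotients_anti {φ : ℝ → ℝ} (hφ : QuasiConcave φ) {q t u : ℝ}
    (hq : 0 ≤ q) (ht : 0 < t) (htu : t ≤ u) (hu : u ≤ 1) :
    sSup (majorantQuotients φ q u) ≤ sSup (majorantQuotients φ q t) := by
  refine csSup_le_csSup (hφ.bddAbove_majorantQuotients hq ht) ⟨_, u, le_rfl, hu, rfl⟩ ?_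
  rintro y ⟨s, hus, hs, rfl⟩
  exact ⟨s, htu.trans hus, hs, rfl⟩

theorem QuasiConcave.rpow_mul_sSup_majorantQuotients_mono {φ : ℝ → ℝ} (hφ : QuasiConcave φ)
    {q t u : ℝ} (hq : 0 ≤ q) (ht : 0 < t) (htu : t ≤ u) (hu : u ≤ 1) :
    t ^ q * sSup (majorantQuotients φ q t) ≤ u ^ q * sSup (majorantQuotients φ q u) := by
  have hu0 : 0 < u := ht.trans_le htu
  have htq : 0 < t ^ q := Real.rpow_pos_of_pos ht q
  have huq : 0 < u ^ q := Real.rpow_pos_of_pos hu0 q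
  rw [mul_comm, ← le_div_iff₀ htq]
  refine csSup_le ⟨_, t, le_rfl, htu.trans hu, rfl⟩ ?_
  rintro y ⟨s, hts, hs, rfl⟩
  have hs0 : 0 < s := ht.trans_le hts
  have hsq : 0 < s ^ q := Real.rpow_pos_of_pos hs0 q
  have hφs : 0 < φ s := hφ.2.1 s hs0
  rw [le_div_iff₀ htq]
  rcases le_total u s with hus | hsu
  · calc φ s / s ^ q * t ^ q ≤ φ s / s ^ q * u ^ q := by
          gcongr
      _ = u ^ q * (φ s / s ^ q) := mul_comm _ _
      _ ≤ _ := by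
          gcongr
          exact hφ.le_sSup_majorantQuotients hq hu0 hus hs
  · calc φ s / s ^ q * t ^ q ≤ φ s / s ^ q * s ^ q := by
          gcongr
      _ = φ s := div_mul_cancel₀ _ hsq.ne'
      _ ≤ φ u := hφ.2.2.1 hs0.le hu0.le hsu
      _ = u ^ q * (φ u / u ^ q) := (mul_div_cancel₀ _ huq.ne').symm
      _ ≤ _ := by
          gcongr
          exact hφ.le_sSup_majorantQuotients hq hu0 le_rfl hu

/-- **Quasi-concavity of the majorant `ψ` on `[0,1)`:** given a quasi-concave `φ` and
`p ∈ [1,∞)`, the function `ψ` defined by `ψ 0 = 0`,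
`ψ t = t^{1/p} · sup_{t ≤ s ≤ 1} φ(s)/s^{1/p}` for `0 < t ≤ 1`, and `ψ t = φ t` for
`t ≥ 1`, has `ψ^p` quasi-concave on `[0,1)`: `ψ > 0` on `(0,1)`, `t ↦ ψ(t)^p` is
nondecreasing on `[0,1)`, and `t ↦ ψ(t)^p / t` is nonincreasing on `(0,1)`. -/
theorem psi_pow_quasiConcave
    (φ : ℝ → ℝ) (hφ : QuasiConcave φ) (p : ℝ) (hp : 1 ≤ p)
    (ψ : ℝ → ℝ) (hψ0 : ψ 0 = 0)
    (hψmid : ∀ t : ℝ, 0 < t → t ≤ 1 →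
      ψ t = t ^ (1 / p) * sSup {y : ℝ | ∃ s : ℝ, t ≤ s ∧ s ≤ 1 ∧ y = φ s / s ^ (1 / p)})
    (hψtop : ∀ t : ℝ, 1 ≤ t → ψ t = φ t) :
    (∀ t ∈ Set.Ioo (0 : ℝ) 1, 0 < ψ t) ∧
      MonotoneOn (fun t => ψ t ^ p) (Set.Ico (0 : ℝ) 1) ∧
      AntitoneOn (fun t => ψ t ^ p / t) (Set.Ioo (0 : ℝ) 1) := by
  have hp0 : 0 < p := one_pos.trans_le hp
  have hq : 0 ≤ 1 / p := by positivity
  have hψ : ∀ t : ℝ, 0 < t → t ≤ 1 →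
      ψ t = t ^ (1 / p) * sSup (majorantQuotients φ (1 / p) t) := hψmid
  have hpos : ∀ t ∈ Set.Ioo (0 : ℝ) 1, 0 < ψ t := fun t ht => by
    rw [hψ t ht.1 ht.2.le]
    exact mul_pos (Real.rpow_pos_of_pos ht.1 _) (hφ.sSup_majorantQuotients_pos hq ht.1 ht.2.le)
  have hdiv : ∀ t ∈ Set.Ioo (0 : ℝ) 1,
      ψ t ^ p / t = sSup (majorantQuotients φ (1 / p) t) ^ p := fun t ht => by
    rw [hψ t ht.1 ht.2.le, Real.mul_rpow (Real.rpow_nonneg ht.1.le _)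
      (hφ.sSup_majorantQuotients_pos hq ht.1 ht.2.le).le, ← Real.rpow_mul ht.1.le,
      one_div_mul_cancel hp0.ne', Real.rpow_one, mul_div_cancel_left₀ _ ht.1.ne']
  refine ⟨hpos, fun t ht u hu htu => ?_, fun t ht u hu htu => ?_⟩
  · rcases ht.1.eq_or_lt with rfl | ht0
    · rcases hu.1.eq_or_lt with rfl | hu0
      · exact le_rfl
      · simpa [hψ0, Real.zero_rpow hp0.ne'] using Real.rpow_nonneg (hpos u ⟨hu0, hu.2⟩).le p
    · refine Real.rpow_le_rpow (hpos t ⟨ht0, ht.2⟩).le ?_ hp0.le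
      rw [hψ t ht0 ht.2.le, hψ u (ht0.trans_le htu) hu.2.le]
      exact hφ.rpow_mul_sSup_majorantQuotients_mono hq ht0 htu hu.2.le
  · simp only [hdiv t ht, hdiv u hu]
    exact Real.rpow_le_rpow (hφ.sSup_majorantQuotients_pos hq hu.1 hu.2.le).le
      (hφ.sSup_majorantQuotients_anti hq ht.1 htu hu.2.le) hp0.le
end

section
/- Let φ be quasi-concave and p ∈ [1,∞). Define ψ : [0,∞) → [0,∞) by ψ(0) = 0, ψ(t) = t^{1/p} · sup_{t ≤ s ≤ 1} φ(s)/s^{1/p} for 0 < t ≤ 1, and ψ(t) = φ(t) for t ≥ 1. Then for every nonincreasing f : (0,∞) → [0,∞]: sup_{0<t<1} A_p f(t)·ψ(t) = sup_{0<t<1} A_p f(t)·φ(t), and sup_{t>0} A_p f(t)·ψ(t) = sup_{t>0} A_p f(t)·φ(t). -/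
open MeasureTheory
open scoped ENNReal

/-- The maximal average `A_p f (t) = ((1/t) ∫₀^t f(s)^p ds)^{1/p}`, which for a
nonincreasing `f : (0,∞) → [0,∞]` equals the non-centered maximal function `M_p f (t)`
on `(0,∞)` with Lebesgue measure. -/
noncomputable def Ap (p : ℝ) (f : ℝ → ℝ≥0∞) (t : ℝ) : ℝ≥0∞ :=
  ((ENNReal.ofReal t)⁻¹ * ∫⁻ s in Set.Ioo (0 : ℝ) t, f s ^ p) ^ (1 / p)

theorem ENNReal.mul_ofReal_sSup_le {S : Set ℝ} {J R : ℝ≥0∞} (hpos : ∃ y ∈ S, 0 < y)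
    (h : ∀ y ∈ S, J * ENNReal.ofReal y ≤ R) : J * ENNReal.ofReal (sSup S) ≤ R := by
  obtain ⟨y₀, hy₀, hy₀pos⟩ := hpos
  rcases eq_or_ne J 0 with rfl | hJ0
  · simp
  rcases eq_or_ne J ⊤ with rfl | hJt
  · have h₀ := h y₀ hy₀
    rw [ENNReal.top_mul (by simpa using hy₀pos), top_le_iff] at h₀
    simp [h₀]
  rcases eq_or_ne R ⊤ with rfl | hR
  · simp
  have hfin : R / J ≠ ⊤ := ENNReal.div_ne_top hR hJ0
  have key : ∀ x : ℝ, J * ENNReal.ofReal x ≤ R ↔ x ≤ (R / J).toReal := fun x => by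
    rw [← ENNReal.ofReal_le_iff_le_toReal hfin, mul_comm,
      ENNReal.le_div_iff_mul_le (Or.inl hJ0) (Or.inl hJt)]
  exact (key _).2 (csSup_le ⟨y₀, hy₀⟩ fun y hy => (key y).1 (h y hy))

theorem Ap_mul_ofReal_rpow {p : ℝ} (hp : 1 ≤ p) (f : ℝ → ℝ≥0∞) {t : ℝ} (ht : 0 < t) :
    Ap p f t * ENNReal.ofReal (t ^ (1 / p)) =
      (∫⁻ s in Set.Ioo (0 : ℝ) t, f s ^ p) ^ (1 / p) := by
  have hq : 0 ≤ 1 / p := by positivity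
  rw [Ap, ← ENNReal.ofReal_rpow_of_pos ht, ← ENNReal.mul_rpow_of_nonneg _ _ hq, mul_right_comm,
    ENNReal.inv_mul_cancel (by simpa using ht) ENNReal.ofReal_ne_top, one_mul]

theorem lintegral_rpow_mul_le_Ap_mul {p : ℝ} (hp : 1 ≤ p) (f : ℝ → ℝ≥0∞) {t s : ℝ} (ht : 0 < t)
    (hts : t ≤ s) (a : ℝ) :
    (∫⁻ x in Set.Ioo (0 : ℝ) t, f x ^ p) ^ (1 / p) * ENNReal.ofReal (a / s ^ (1 / p)) ≤
      Ap p f s * ENNReal.ofReal a := by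
  have hs : 0 < s := ht.trans_le hts
  have hsp : 0 < s ^ (1 / p) := Real.rpow_pos_of_pos hs _
  calc _ ≤ (∫⁻ x in Set.Ioo (0 : ℝ) s, f x ^ p) ^ (1 / p) *
        ENNReal.ofReal (a / s ^ (1 / p)) := by
        have : 0 ≤ 1 / p := by positivity
        gcongr
    _ = _ := by
        rw [← Ap_mul_ofReal_rpow hp f hs, mul_assoc, ← ENNReal.ofReal_mul hsp.le,
          mul_div_cancel₀ _ hsp.ne']

theorem QuasiConcave.lintegral_rpow_mul_le_iSup {φ : ℝ → ℝ} (hφ : QuasiConcave φ) {p : ℝ}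
    (hp : 1 ≤ p) (f : ℝ → ℝ≥0∞) {t s : ℝ} (ht : 0 < t) (ht1 : t < 1) (hts : t ≤ s) (hs1 : s ≤ 1) :
    (∫⁻ x in Set.Ioo (0 : ℝ) t, f x ^ p) ^ (1 / p) * ENNReal.ofReal (φ s / s ^ (1 / p)) ≤
      ⨆ r ∈ Set.Ioo (0 : ℝ) 1, Ap p f r * ENNReal.ofReal (φ r) := by
  have hlt : ∀ r, t ≤ r → r < 1 →
      (∫⁻ x in Set.Ioo (0 : ℝ) t, f x ^ p) ^ (1 / p) * ENNReal.ofReal (φ r / r ^ (1 / p)) ≤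
        ⨆ r ∈ Set.Ioo (0 : ℝ) 1, Ap p f r * ENNReal.ofReal (φ r) := fun r htr hr =>
    (lintegral_rpow_mul_le_Ap_mul hp f ht htr _).trans
      (le_iSup₂_of_le r ⟨ht.trans_le htr, hr⟩ le_rfl)
  rcases hs1.lt_or_eq with hs1 | rfl
  · exact hlt s hts hs1
  set J := (∫⁻ x in Set.Ioo (0 : ℝ) t, f x ^ p) ^ (1 / p)
  have hlim : Filter.Tendsto (fun r : ℝ => ENNReal.ofReal r * (J * ENNReal.ofReal (φ 1)))
      (nhdsWithin 1 (Set.Iio 1)) (nhds (1 * (J * ENNReal.ofReal (φ 1)))) := by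
    refine ENNReal.Tendsto.mul_const ?_ (Or.inl one_ne_zero)
    have := (ENNReal.continuous_ofReal.tendsto 1).mono_left
      (nhdsWithin_le_nhds (s := Set.Iio (1 : ℝ)))
    simpa using this
  simp only [Real.one_rpow, div_one]
  rw [one_mul] at hlim
  refine le_of_tendsto hlim ?_
  filter_upwards [Ioo_mem_nhdsLT ht1] with r hr
  have hr0 : 0 < r := ht.trans hr.1
  refine le_trans ?_ (hlt r hr.1.le hr.2)
  rw [mul_left_comm, ← ENNReal.ofReal_mul hr0.le]
  gcongr
  have h₁ : φ 1 / 1 ≤ φ r / r := hφ.2.2.2 hr0 (Set.mem_Ioi.2 one_pos) hr.2.le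
  rw [div_one, le_div_iff₀ hr0] at h₁
  have h₂ : r ^ (1 / p) ≤ 1 := Real.rpow_le_one hr0.le hr.2.le (by positivity)
  have h₃ : 0 < r ^ (1 / p) := Real.rpow_pos_of_pos hr0 _
  calc r * φ 1 ≤ φ r := by linarith
    _ ≤ φ r / r ^ (1 / p) := le_div_self (hφ.2.1 r hr0).le h₃ h₂

theorem QuasiConcave.bddAbove_div_rpow {φ : ℝ → ℝ} (hφ : QuasiConcave φ) {p : ℝ} (hp : 1 ≤ p)
    {t : ℝ} (ht : 0 < t) :
    BddAbove {y : ℝ | ∃ s : ℝ, t ≤ s ∧ s ≤ 1 ∧ y = φ s / s ^ (1 / p)} := by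
  refine ⟨φ 1 / t ^ (1 / p), ?_⟩
  rintro _ ⟨s, hts, hs1, rfl⟩
  have hs := ht.trans_le hts
  have htp : 0 < t ^ (1 / p) := Real.rpow_pos_of_pos ht _
  exact div_le_div₀ (hφ.2.1 1 one_pos).le (hφ.2.2.1 hs.le (Set.mem_Ici.2 zero_le_one) hs1) htp
    (Real.rpow_le_rpow ht.le hts (by positivity))

/-- **The Marcinkiewicz-type norms built from `φ` and from its majorant `ψ` coincide:**
for quasi-concave `φ`, `p ∈ [1,∞)` and `ψ` defined by `ψ 0 = 0`,
`ψ t = t^{1/p} · sup_{t ≤ s ≤ 1} φ(s)/s^{1/p}` for `0 < t ≤ 1`, `ψ t = φ t` for `t ≥ 1`: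
for every nonincreasing `f : (0,∞) → [0,∞]`,
`sup_{0<t<1} A_p f(t) ψ(t) = sup_{0<t<1} A_p f(t) φ(t)` and
`sup_{t>0} A_p f(t) ψ(t) = sup_{t>0} A_p f(t) φ(t)`. -/
theorem Mp_norms_psi_eq_phi
    (φ : ℝ → ℝ) (hφ : QuasiConcave φ) (p : ℝ) (hp : 1 ≤ p)
    (ψ : ℝ → ℝ) (hψ0 : ψ 0 = 0)
    (hψmid : ∀ t : ℝ, 0 < t → t ≤ 1 →
      ψ t = t ^ (1 / p) * sSup {y : ℝ | ∃ s : ℝ, t ≤ s ∧ s ≤ 1 ∧ y = φ s / s ^ (1 / p)})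
    (hψtop : ∀ t : ℝ, 1 ≤ t → ψ t = φ t)
    (f : ℝ → ℝ≥0∞) (hf : AntitoneOn f (Set.Ioi 0)) :
    (⨆ t ∈ Set.Ioo (0 : ℝ) 1, Ap p f t * ENNReal.ofReal (ψ t)) =
        (⨆ t ∈ Set.Ioo (0 : ℝ) 1, Ap p f t * ENNReal.ofReal (φ t)) ∧
      (⨆ t ∈ Set.Ioi (0 : ℝ), Ap p f t * ENNReal.ofReal (ψ t)) =
        (⨆ t ∈ Set.Ioi (0 : ℝ), Ap p f t * ENNReal.ofReal (φ t)) := by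
  have hle : ∀ t, 0 < t → φ t ≤ ψ t := fun t ht => by
    rcases le_total 1 t with h1 | h1
    · exact (hψtop t h1).ge
    · rw [hψmid t ht h1, mul_comm, ← div_le_iff₀ (Real.rpow_pos_of_pos ht _)]
      exact le_csSup (hφ.bddAbove_div_rpow hp ht) ⟨t, le_rfl, h1, rfl⟩
  have hge : ∀ t, 0 < t → t < 1 → Ap p f t * ENNReal.ofReal (ψ t) ≤
      ⨆ r ∈ Set.Ioo (0 : ℝ) 1, Ap p f r * ENNReal.ofReal (φ r) := fun t ht ht1 => by
    have htp : 0 < t ^ (1 / p) := Real.rpow_pos_of_pos ht _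
    rw [hψmid t ht ht1.le, ENNReal.ofReal_mul htp.le, ← mul_assoc, Ap_mul_ofReal_rpow hp f ht]
    refine ENNReal.mul_ofReal_sSup_le
      ⟨φ t / t ^ (1 / p), ⟨t, le_rfl, ht1.le, rfl⟩, div_pos (hφ.2.1 t ht) htp⟩ ?_
    rintro _ ⟨s, hts, hs1, rfl⟩
    exact hφ.lintegral_rpow_mul_le_iSup hp f ht ht1 hts hs1
  refine ⟨le_antisymm (iSup₂_le fun t ht => hge t ht.1 ht.2) (iSup₂_mono fun t ht => ?_),
    le_antisymm (iSup₂_le fun t ht => ?_) (iSup₂_mono fun t ht => ?_)⟩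
  · gcongr
    exact hle t ht.1
  · rcases lt_or_ge t 1 with h1 | h1
    · exact (hge t ht h1).trans (biSup_mono fun _ hr => hr.1)
    · rw [hψtop t h1]
      exact le_iSup₂_of_le t ht le_rfl
  · gcongr
    exact hle t ht
end

section
/- Let p ∈ [1,∞) and let ψ : (0,1) → (0,∞) be such that t ↦ ψ(t)^p/t is nonincreasing on (0,1). Then for every nonincreasing f : (0,∞) → [0,∞]: sup_{0<t<1} A_p f(t)·ψ(t) ≤ ( ∫₀^1 f(s)^p·ψ(s)^p ds/s )^{1/p}. (This expresses the embedding Λ^p_ψ ↪ M^p_{ψ,loc}.) -/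
open MeasureTheory
open scoped ENNReal

/-- **The embedding `Λ^p_ψ ↪ M^p_{ψ,loc}`:** if `p ∈ [1,∞)` and `ψ : (0,1) → (0,∞)` is
such that `t ↦ ψ(t)^p / t` is nonincreasing on `(0,1)`, then for every nonincreasing
`f : (0,∞) → [0,∞]`,
`sup_{0<t<1} A_p f(t) ψ(t) ≤ (∫₀^1 f(s)^p ψ(s)^p ds/s)^{1/p}`. -/
theorem lorentz_embeds_MpLoc
    (p : ℝ) (hp : 1 ≤ p) (ψ : ℝ → ℝ)
    (hψpos : ∀ t ∈ Set.Ioo (0 : ℝ) 1, 0 < ψ t)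
    (hψ : AntitoneOn (fun t => ψ t ^ p / t) (Set.Ioo (0 : ℝ) 1))
    (f : ℝ → ℝ≥0∞) (hf : AntitoneOn f (Set.Ioi 0)) :
    (⨆ t ∈ Set.Ioo (0 : ℝ) 1, Ap p f t * ENNReal.ofReal (ψ t)) ≤
      (∫⁻ s in Set.Ioo (0 : ℝ) 1,
        f s ^ p * ENNReal.ofReal (ψ s ^ p) * ENNReal.ofReal (1 / s)) ^ (1 / p) := by
  have hp0 : 0 < p := by linarith
  refine iSup₂_le fun t ht => ?_
  have hψt : ENNReal.ofReal (ψ t) = ENNReal.ofReal (ψ t ^ p) ^ (1 / p) := by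
    rw [← ENNReal.ofReal_rpow_of_pos (hψpos t ht), ← ENNReal.rpow_mul,
      mul_one_div_cancel hp0.ne', ENNReal.rpow_one]
  rw [Ap, hψt, ← ENNReal.mul_rpow_of_nonneg _ _ (by positivity)]
  refine ENNReal.rpow_le_rpow ?_ (by positivity)
  calc (ENNReal.ofReal t)⁻¹ * (∫⁻ s in Set.Ioo (0 : ℝ) t, f s ^ p) * ENNReal.ofReal (ψ t ^ p)
      = ENNReal.ofReal (ψ t ^ p / t) * ∫⁻ s in Set.Ioo (0 : ℝ) t, f s ^ p := by
        rw [ENNReal.ofReal_div_of_pos ht.1, div_eq_mul_inv]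
        ring
    _ ≤ ∫⁻ s in Set.Ioo (0 : ℝ) t, ENNReal.ofReal (ψ t ^ p / t) * f s ^ p :=
        lintegral_const_mul_le _ _
    _ ≤ ∫⁻ s in Set.Ioo (0 : ℝ) t,
          f s ^ p * ENNReal.ofReal (ψ s ^ p) * ENNReal.ofReal (1 / s) := by
        refine setLIntegral_mono' measurableSet_Ioo fun s hs => ?_
        have hs1 : s ∈ Set.Ioo (0 : ℝ) 1 := ⟨hs.1, hs.2.trans ht.2⟩
        rw [mul_assoc, ← ENNReal.ofReal_mul (Real.rpow_nonneg (hψpos s hs1).le p),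
          mul_one_div, mul_comm]
        exact mul_le_mul_right (ENNReal.ofReal_le_ofReal (hψ hs1 ht hs.2.le)) _
    _ ≤ ∫⁻ s in Set.Ioo (0 : ℝ) 1,
          f s ^ p * ENNReal.ofReal (ψ s ^ p) * ENNReal.ofReal (1 / s) :=
        lintegral_mono_set (Set.Ioo_subset_Ioo_right ht.2.le)
end

section
/- Let φ be quasi-concave and p ∈ [1,∞). Then the following are equivalent: (i) for every b > 0 there exists c_b > 0 such that for every nonincreasing f : (0,∞) → [0,∞] one has sup_{0<t<b} A_p f(t)·φ(t) ≤ c_b · sup_{t>0} f(t)·φ(t); (ii) sup_{0<t<1} φ(t)^p · (1/t) ∫₀^t φ(s)^{−p} ds < ∞. (This characterizes the boundedness of M_p from the weak Marcinkiewicz space M^*_φ to M^*_φ on sets of finite measure.) -/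
open MeasureTheory
open scoped ENNReal NNReal

/-- The weak Marcinkiewicz extremal function `1 / φ` turns the norm inequality for `Ap` into the
averaging condition on `φ`. -/
theorem Ap_one_div_mul_rpow {φ : ℝ → ℝ} (hpos : ∀ t : ℝ, 0 < t → 0 < φ t) {p : ℝ} (hp : 1 ≤ p)
    {t : ℝ} (ht : 0 < t) :
    (Ap p (fun s => ENNReal.ofReal (1 / φ s)) t * ENNReal.ofReal (φ t)) ^ p =
      ENNReal.ofReal (φ t ^ p) * ((ENNReal.ofReal t)⁻¹ *
        ∫⁻ s in Set.Ioo (0 : ℝ) t, ENNReal.ofReal (1 / φ s ^ p)) := by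
  have hp0 : 0 < p := by linarith
  have hint : ∫⁻ s in Set.Ioo (0 : ℝ) t, ENNReal.ofReal (1 / φ s) ^ p =
      ∫⁻ s in Set.Ioo (0 : ℝ) t, ENNReal.ofReal (1 / φ s ^ p) := by
    refine setLIntegral_congr_fun measurableSet_Ioo fun s hs => ?_
    have hs' := hpos s hs.1
    rw [ENNReal.ofReal_rpow_of_pos (by positivity), Real.div_rpow zero_le_one hs'.le,
      Real.one_rpow]
  rw [Ap, hint, ENNReal.mul_rpow_of_nonneg _ _ hp0.le, ← ENNReal.rpow_mul,
    one_div_mul_cancel hp0.ne', ENNReal.rpow_one, ENNReal.ofReal_rpow_of_pos (hpos t ht), mul_comm]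

/-- Pointwise domination by a multiple passes to `Ap`. -/
theorem Ap_le_const_mul {p : ℝ} (hp : 1 ≤ p) {f g : ℝ → ℝ≥0∞} {S : ℝ≥0∞} (hS : S ≠ ⊤)
    (h : ∀ s, 0 < s → f s ≤ S * g s) (t : ℝ) : Ap p f t ≤ S * Ap p g t := by
  have hp0 : 0 < p := by linarith
  have hint : ∫⁻ s in Set.Ioo (0 : ℝ) t, f s ^ p ≤ S ^ p * ∫⁻ s in Set.Ioo (0 : ℝ) t, g s ^ p := by
    rw [← lintegral_const_mul' _ _ (ENNReal.rpow_ne_top_of_nonneg hp0.le hS)]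
    refine setLIntegral_mono' measurableSet_Ioo fun s hs => ?_
    rw [← ENNReal.mul_rpow_of_nonneg _ _ hp0.le]
    exact ENNReal.rpow_le_rpow (h s hs.1) hp0.le
  calc Ap p f t
      ≤ (S ^ p * ((ENNReal.ofReal t)⁻¹ * ∫⁻ s in Set.Ioo (0 : ℝ) t, g s ^ p)) ^ (1 / p) := by
        rw [Ap, mul_left_comm]
        gcongr
    _ = S * Ap p g t := by
        rw [ENNReal.mul_rpow_of_nonneg _ _ (by positivity), ← ENNReal.rpow_mul,
          mul_one_div_cancel hp0.ne', ENNReal.rpow_one, Ap]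

/-- If the averages of `φ ^ (-p)` are controlled on `(0,1)`, they are controlled on every
bounded interval. -/
theorem exists_average_bound {φ : ℝ → ℝ} (hpos : ∀ t : ℝ, 0 < t → 0 < φ t)
    (hmono : MonotoneOn φ (Set.Ici 0)) {p : ℝ} (hp : 1 ≤ p)
    (h : (⨆ t ∈ Set.Ioo (0 : ℝ) 1,
        ENNReal.ofReal (φ t ^ p) * ((ENNReal.ofReal t)⁻¹ *
          ∫⁻ s in Set.Ioo (0 : ℝ) t, ENNReal.ofReal (1 / φ s ^ p))) < ⊤) (b : ℝ) :
    ∃ C : ℝ≥0∞, C ≠ ⊤ ∧ ∀ t ∈ Set.Ioo (0 : ℝ) b,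
      ENNReal.ofReal (φ t ^ p) * ((ENNReal.ofReal t)⁻¹ *
        ∫⁻ s in Set.Ioo (0 : ℝ) t, ENNReal.ofReal (1 / φ s ^ p)) ≤ C := by
  have hp0 : 0 < p := by linarith
  set J : ℝ → ℝ≥0∞ := fun t => ∫⁻ s in Set.Ioo (0 : ℝ) t, ENNReal.ofReal (1 / φ s ^ p) with hJ
  set M := ⨆ t ∈ Set.Ioo (0 : ℝ) 1, ENNReal.ofReal (φ t ^ p) * ((ENNReal.ofReal t)⁻¹ * J t) with hM
  have hle : ∀ t ∈ Set.Ioo (0 : ℝ) 1,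
      ENNReal.ofReal (φ t ^ p) * ((ENNReal.ofReal t)⁻¹ * J t) ≤ M := fun t ht =>
    le_iSup₂ (f := fun t (_ : t ∈ Set.Ioo (0 : ℝ) 1) =>
      ENNReal.ofReal (φ t ^ p) * ((ENNReal.ofReal t)⁻¹ * J t)) t ht
  have hhalf : J (1 / 2) ≠ ⊤ := by
    intro htop
    have hφ2 : 0 < φ (1 / 2) ^ p := Real.rpow_pos_of_pos (hpos _ (by norm_num)) _
    have h2 := hle (1 / 2) (by norm_num)
    rw [htop, ENNReal.mul_top (ENNReal.inv_ne_zero.2 ENNReal.ofReal_ne_top),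
      ENNReal.mul_top (ENNReal.ofReal_pos.2 hφ2).ne'] at h2
    exact (h2.trans_lt h).ne rfl
  have hJb : J b ≠ ⊤ := by
    refine ne_top_of_le_ne_top (ENNReal.add_ne_top.2 ⟨hhalf, ?_⟩)
      ((lintegral_mono_set (t := Set.Ioo (0 : ℝ) (1 / 2) ∪ Set.Ico (1 / 2) b) ?_).trans
        (lintegral_union_le _ _ _))
    · refine ne_top_of_le_ne_top ?_ (setLIntegral_mono' (g := fun _ =>
        ENNReal.ofReal (1 / φ (1 / 2) ^ p)) measurableSet_Ico fun s hs => ?_)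
      · rw [setLIntegral_const, Real.volume_Ico]
        exact ENNReal.mul_ne_top ENNReal.ofReal_ne_top ENNReal.ofReal_ne_top
      · have h0 : (0 : ℝ) < 1 / 2 := by norm_num
        have h1 : φ (1 / 2) ≤ φ s := hmono h0.le (h0.le.trans hs.1) hs.1
        have h2 := hpos _ h0
        gcongr
    · intro s hs
      rcases lt_or_ge s (1 / 2) with h2 | h2
      · exact Or.inl ⟨hs.1, h2⟩
      · exact Or.inr ⟨h2, hs.2⟩
  refine ⟨M + ENNReal.ofReal (φ b ^ p) * J b,
    ENNReal.add_ne_top.2 ⟨h.ne, ENNReal.mul_ne_top ENNReal.ofReal_ne_top hJb⟩, fun t ht => ?_⟩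
  rcases lt_or_ge t 1 with h1 | h1
  · exact (hle t ⟨ht.1, h1⟩).trans le_self_add
  · refine le_trans ?_ le_add_self
    have hb : φ t ≤ φ b := hmono ht.1.le (ht.1.le.trans ht.2.le) ht.2.le
    have hJt : J t ≤ J b := lintegral_mono_set (Set.Ioo_subset_Ioo_right ht.2.le)
    have hinv : (ENNReal.ofReal t)⁻¹ ≤ 1 :=
      ENNReal.inv_le_one.2 (ENNReal.one_le_ofReal.2 h1)
    have h0 := hpos t ht.1
    calc _ ≤ ENNReal.ofReal (φ b ^ p) * (1 * J b) := by gcongr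
      _ = _ := by rw [one_mul]

/-- **Characterization of the boundedness of `M_p : M^*_φ → M^*_φ` on sets of finite
measure:** for quasi-concave `φ` and `p ∈ [1,∞)`, the estimate
`sup_{0<t<b} A_p f(t) φ(t) ≤ c_b · sup_{t>0} f(t) φ(t)` (for all nonincreasing `f`, with
some `c_b > 0` for each `b > 0`) holds if and only if
`sup_{0<t<1} φ(t)^p (1/t) ∫₀^t φ(s)^{−p} ds < ∞`. -/
theorem maximal_weakMarcinkiewicz_bounded_iff
    (φ : ℝ → ℝ) (hφ : QuasiConcave φ) (p : ℝ) (hp : 1 ≤ p) :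
    (∀ b : ℝ, 0 < b → ∃ c : ℝ≥0, 0 < c ∧
      ∀ f : ℝ → ℝ≥0∞, AntitoneOn f (Set.Ioi 0) →
        (⨆ t ∈ Set.Ioo (0 : ℝ) b, Ap p f t * ENNReal.ofReal (φ t)) ≤
          (c : ℝ≥0∞) * ⨆ t ∈ Set.Ioi (0 : ℝ), f t * ENNReal.ofReal (φ t)) ↔
    (⨆ t ∈ Set.Ioo (0 : ℝ) 1,
        ENNReal.ofReal (φ t ^ p) * ((ENNReal.ofReal t)⁻¹ *
          ∫⁻ s in Set.Ioo (0 : ℝ) t, ENNReal.ofReal (1 / φ s ^ p))) < ⊤ := by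
  have hp0 : 0 < p := by linarith
  obtain ⟨-, hpos, hmono, -⟩ := hφ
  have hcancel : ∀ t : ℝ, 0 < t → ENNReal.ofReal (1 / φ t) * ENNReal.ofReal (φ t) = 1 := by
    intro t ht
    have h := hpos t ht
    rw [← ENNReal.ofReal_mul (by positivity), one_div_mul_cancel h.ne', ENNReal.ofReal_one]
  constructor
  · intro h
    obtain ⟨c, -, hc⟩ := h 1 one_pos
    have hanti : AntitoneOn (fun s => ENNReal.ofReal (1 / φ s)) (Set.Ioi 0) := by
      intro s hs t ht hst
      have h0 := hpos s hs
      have h1 := hmono (Set.Ioi_subset_Ici_self hs) (Set.Ioi_subset_Ici_self ht) hst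
      dsimp only
      gcongr
    have hle := (hc _ hanti).trans (mul_le_mul_right (iSup₂_le fun t ht => (hcancel t ht).le) _)
    rw [mul_one] at hle
    refine lt_of_le_of_lt (iSup₂_le fun t ht => ?_)
      (ENNReal.rpow_lt_top_of_nonneg hp0.le (ENNReal.coe_ne_top (r := c)))
    rw [← Ap_one_div_mul_rpow hpos hp ht.1]
    exact ENNReal.rpow_le_rpow ((iSup₂_le_iff.1 hle) t ht) hp0.le
  · intro h b _
    obtain ⟨C, hC, hK⟩ := exists_average_bound hpos hmono hp h b
    have hC' : C ^ (1 / p) ≠ ⊤ := ENNReal.rpow_ne_top_of_nonneg (by positivity) hC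
    refine ⟨(C ^ (1 / p)).toNNReal + 1, by positivity, fun f _ => ?_⟩
    set S := ⨆ t ∈ Set.Ioi (0 : ℝ), f t * ENNReal.ofReal (φ t) with hS
    by_cases hStop : S = ⊤
    · rw [hStop, ENNReal.mul_top (by simp)]
      exact le_top
    have hf : ∀ s, 0 < s → f s ≤ S * ENNReal.ofReal (1 / φ s) := by
      intro s hs
      have hfs : f s * ENNReal.ofReal (φ s) ≤ S :=
        le_iSup₂ (f := fun t (_ : t ∈ Set.Ioi (0 : ℝ)) => f t * ENNReal.ofReal (φ t)) s hs
      calc f s = f s * ENNReal.ofReal (φ s) * ENNReal.ofReal (1 / φ s) := by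
            rw [mul_assoc, mul_comm (ENNReal.ofReal (φ s)), hcancel s hs, mul_one]
        _ ≤ _ := by gcongr
    refine iSup₂_le fun t ht => ?_
    have hg : Ap p (fun s => ENNReal.ofReal (1 / φ s)) t * ENNReal.ofReal (φ t) ≤ C ^ (1 / p) := by
      rw [one_div, ENNReal.le_rpow_inv_iff hp0, Ap_one_div_mul_rpow hpos hp ht.1]
      exact hK t ht
    calc Ap p f t * ENNReal.ofReal (φ t)
        ≤ S * Ap p (fun s => ENNReal.ofReal (1 / φ s)) t * ENNReal.ofReal (φ t) := by
          gcongr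
          exact Ap_le_const_mul hp hStop hf t
      _ ≤ S * C ^ (1 / p) := by
          rw [mul_assoc]
          gcongr
      _ ≤ _ := by
          rw [mul_comm, ENNReal.coe_add, ENNReal.coe_toNNReal hC']
          gcongr
          exact le_self_add
end
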